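/- arXiv:1512.03446 — 2 statements merged into one kernel-verified Lean document; each statement's English description precedes it below -/
import Mathlib

section
/- Let q be a prime power, ψ : 𝔽_q → ℂ a nontrivial additive character, N ≥ 0, and P a normal subposet of the chain on {1,…,N}. Let λ and μ be partial permutation matrices supported on P (0-1 matrices with λ_{ij} = 0 and μ_{ij} = 0 unless i P j, and at most one 1 per row and per column). If there exist i < j < k with λ_{ik} = μ_{ij} = 1 or with λ_{ik} = μ_{jk} = 1, then χ^λ(1 + μ) = 0. Otherwise, χ^λ(1 + μ) = (−1)^{|λ∩μ|} · (q−1)^{|λ| − |λ∩μ|} · q^{dim_L(λ) + dim_R(λ) − crs(λ) − nst^λ_μ}, where dim_L(λ) = #{(i,j,k) : i P j, j < k, λ_{ik} = 1}, dim_R(λ) = #{(i,j,k) : i < j, j P k, λ_{ik} = 1}, crs(λ) = #{(i,j,k,l) : i < j, j P k, k < l, λ_{ik} = λ_{jl} = 1}, nst^λ_μ = #{(i,j,k,l) : i < j, k < l, λ_{il} = μ_{jk} = 1}, |λ| = # of ones of λ, and |λ∩μ| = #{(i,j) : λ_{ij} = μ_{ij} = 1}. -/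
open scoped Classical

noncomputable section

/-- A subposet of the chain `0 < 1 < ⋯ < l-1`: a transitive relation contained in `<`. -/
def IsChainSubposet {l : ℕ} (P : Fin l → Fin l → Prop) : Prop :=
  (∀ i j k, P i j → P j k → P i k) ∧ ∀ i j, P i j → i < j

/-- A normal subposet of the chain. -/
def IsNormalChainSubposet {l : ℕ} (P : Fin l → Fin l → Prop) : Prop :=
  IsChainSubposet P ∧ (∀ i j k, P j k → i < j → P i k) ∧ ∀ j k m, P j k → k < m → P j m

/-- The relation `fat_β(P)` on `Fin N` obtained from a relation `P` on block indices. -/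
def fatR {N l : ℕ} (blk : Fin N → Fin l) (P : Fin l → Fin l → Prop) :
    Fin N → Fin N → Prop := fun r s => P (blk r) (blk s)

/-- The "pattern group" of a relation: unipotent matrices supported on the relation. -/
def UTgrp (F : Type) [Field F] {N : ℕ} (R : Fin N → Fin N → Prop) :
    Set (Matrix (Fin N) (Fin N) F) :=
  {g | (∀ r, g r r = 1) ∧ ∀ r s, r ≠ s → ¬ R r s → g r s = 0}

/-- The nilpotent "pattern algebra" of a relation. -/
def utAlg (F : Type) [Field F] {N : ℕ} (R : Fin N → Fin N → Prop) :
    Set (Matrix (Fin N) (Fin N) F) :=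
  {x | ∀ r s, ¬ R r s → x r s = 0}

/-- The parabolic subgroup `P_β`: invertible block upper-triangular matrices. -/
def parab (F : Type) [Field F] {N l : ℕ} (blk : Fin N → Fin l) :
    Set (Matrix (Fin N) (Fin N) F) :=
  {g | IsUnit g ∧ ∀ r s, ¬ blk r ≤ blk s → g r s = 0}

/-- The Levi subgroup `L_β`: invertible block diagonal matrices. -/
def levi (F : Type) [Field F] {N l : ℕ} (blk : Fin N → Fin l) :
    Set (Matrix (Fin N) (Fin N) F) :=
  {g | IsUnit g ∧ ∀ r s, blk r ≠ blk s → g r s = 0}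

/-- The opposite unipotent radical `U⁻_β`: block lower uni-triangular matrices. -/
def uminus (F : Type) [Field F] {N l : ℕ} (blk : Fin N → Fin l) :
    Set (Matrix (Fin N) (Fin N) F) :=
  {g | (∀ r, g r r = 1) ∧ ∀ r s, r ≠ s → ¬ blk s < blk r → g r s = 0}

/-- Truncation of a matrix to the positions of a relation. -/
def trunc {F : Type} [Field F] {N : ℕ} (R : Fin N → Fin N → Prop)
    (x : Matrix (Fin N) (Fin N) F) : Matrix (Fin N) (Fin N) F :=
  fun r s => if R r s then x r s else 0

/-- The two-sided orbit `O(Y)` of `Y` under the block lower-triangular invertible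
matrices, truncated back to the positions of `R`. -/
def orb (F : Type) [Field F] {N l : ℕ} (blk : Fin N → Fin l) (R : Fin N → Fin N → Prop)
    (Y : Matrix (Fin N) (Fin N) F) : Set (Matrix (Fin N) (Fin N) F) :=
  {Z | ∃ g h : Matrix (Fin N) (Fin N) F, IsUnit g ∧ IsUnit h ∧
      (∀ r s, blk r < blk s → g r s = 0) ∧ (∀ r s, blk r < blk s → h r s = 0) ∧
      Z = trunc R (g * Y * h)}

/-- The supercharacter `χ^Y` as a function on matrices. -/
def chi {F : Type} [Field F] [Fintype F] (ψ : F → ℂ) {N l : ℕ} (blk : Fin N → Fin l)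
    (R : Fin N → Fin N → Prop) (Y u : Matrix (Fin N) (Fin N) F) : ℂ :=
  ∑ᶠ Z ∈ orb F blk R Y, ψ (∑ r, ∑ s, Z r s * (u - 1) r s)

/-- A partial permutation matrix: 0-1 entries, at most one 1 in each row and column. -/
def IsPPM {F : Type} [Field F] {N : ℕ} (x : Matrix (Fin N) (Fin N) F) : Prop :=
  (∀ r s, x r s = 0 ∨ x r s = 1) ∧
  (∀ r s t, x r s ≠ 0 → x r t ≠ 0 → s = t) ∧
  (∀ r s t, x r t ≠ 0 → x s t ≠ 0 → r = s)

/-- The rank of the block of `x` with rows in block `i` and columns in block `j`. -/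
def blockRank {F : Type} [Field F] {N l : ℕ} (blk : Fin N → Fin l)
    (x : Matrix (Fin N) (Fin N) F) (i j : Fin l) : ℕ :=
  (x.submatrix (fun r : {r : Fin N // blk r = i} => (r : Fin N))
    (fun s : {s : Fin N // blk s = j} => (s : Fin N))).rank

end

noncomputable section

/-- `dim_L(λ) = #{(i,j,k) : i P j, j < k, λ_{ik} = 1}`. -/
def pDimL {F : Type} [Field F] {N : ℕ} (P : Fin N → Fin N → Prop)
    (lam : Matrix (Fin N) (Fin N) F) : ℕ :=
  (Finset.univ.filter (fun t : Fin N × Fin N × Fin N =>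
    P t.1 t.2.1 ∧ t.2.1 < t.2.2 ∧ lam t.1 t.2.2 = 1)).card

/-- `dim_R(λ) = #{(i,j,k) : i < j, j P k, λ_{ik} = 1}`. -/
def pDimR {F : Type} [Field F] {N : ℕ} (P : Fin N → Fin N → Prop)
    (lam : Matrix (Fin N) (Fin N) F) : ℕ :=
  (Finset.univ.filter (fun t : Fin N × Fin N × Fin N =>
    t.1 < t.2.1 ∧ P t.2.1 t.2.2 ∧ lam t.1 t.2.2 = 1)).card

/-- `crs(λ) = #{(i,j,k,l) : i < j, j P k, k < l, λ_{ik} = λ_{jl} = 1}`. -/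
def pCrs {F : Type} [Field F] {N : ℕ} (P : Fin N → Fin N → Prop)
    (lam : Matrix (Fin N) (Fin N) F) : ℕ :=
  (Finset.univ.filter (fun t : Fin N × Fin N × Fin N × Fin N =>
    t.1 < t.2.1 ∧ P t.2.1 t.2.2.1 ∧ t.2.2.1 < t.2.2.2 ∧
    lam t.1 t.2.2.1 = 1 ∧ lam t.2.1 t.2.2.2 = 1)).card

/-- `nst^λ_μ = #{(i,j,k,l) : i < j, k < l, λ_{il} = μ_{jk} = 1}`. -/
def pNst {F : Type} [Field F] {N : ℕ} (lam mu : Matrix (Fin N) (Fin N) F) : ℕ :=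
  (Finset.univ.filter (fun t : Fin N × Fin N × Fin N × Fin N =>
    t.1 < t.2.1 ∧ t.2.2.1 < t.2.2.2 ∧
    lam t.1 t.2.2.2 = 1 ∧ mu t.2.1 t.2.2.1 = 1)).card

/-- Number of ones, and number of common ones, of 0-1 matrices. -/
def pSize {F : Type} [Field F] {N : ℕ} (lam : Matrix (Fin N) (Fin N) F) : ℕ :=
  (Finset.univ.filter (fun p : Fin N × Fin N => lam p.1 p.2 = 1)).card

def pInter {F : Type} [Field F] {N : ℕ} (lam mu : Matrix (Fin N) (Fin N) F) : ℕ :=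
  (Finset.univ.filter (fun p : Fin N × Fin N => lam p.1 p.2 = 1 ∧ mu p.1 p.2 = 1)).card

/-- Functions supported on a finset. -/
def suppF (F : Type) [Field F] [Fintype F] {N : ℕ} (W : Finset (Fin N)) :
    Finset (Fin N → F) :=
  Fintype.piFinset (fun s => if s ∈ W then Finset.univ else {0})

theorem mem_suppF {F : Type} [Field F] [Fintype F] {N : ℕ} (W : Finset (Fin N))
    (w : Fin N → F) : w ∈ suppF F W ↔ ∀ s, s ∉ W → w s = 0 := by
  unfold suppF
  rw [Fintype.mem_piFinset]
  refine forall_congr' fun s => ?_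
  by_cases h : s ∈ W <;> simp [h]

theorem psi_sum {F : Type} [Field F] (ψ : F → ℂ)
    (hψadd : ∀ a b, ψ (a + b) = ψ a * ψ b) (hψ0 : ψ 0 = 1) {ι : Type*} (S : Finset ι)
    (f : ι → F) : ψ (∑ i ∈ S, f i) = ∏ i ∈ S, ψ (f i) := by
  induction S using Finset.induction_on with
  | empty => simpa using hψ0
  | insert a s ha ih => rw [Finset.sum_insert ha, Finset.prod_insert ha, hψadd, ih]

theorem psi_tot {F : Type} [Field F] [Fintype F] (ψ : F → ℂ)
    (hψadd : ∀ a b, ψ (a + b) = ψ a * ψ b) (hψnt : ∃ a, ψ a ≠ 1) : ∑ c, ψ c = 0 := by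
  obtain ⟨b, hb⟩ := hψnt
  have h1 : ∑ a, ψ (b + a) = ∑ a, ψ a :=
    Fintype.sum_bijective _ (AddGroup.addLeft_bijective b) _ _ fun x => rfl
  simp_rw [hψadd, ← Finset.mul_sum] at h1
  have h2 : (ψ b - 1) * ∑ a, ψ a = 0 := by rw [sub_mul, h1]; ring
  rcases mul_eq_zero.1 h2 with h | h
  · exact absurd (sub_eq_zero.1 h) hb
  · exact h

theorem psi_lin {F : Type} [Field F] [Fintype F] (ψ : F → ℂ)
    (hψadd : ∀ a b, ψ (a + b) = ψ a * ψ b) (hψ0 : ψ 0 = 1) (hψnt : ∃ a, ψ a ≠ 1) (L : F) :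
    ∑ c, ψ (c * L) = if L = 0 then (Fintype.card F : ℂ) else 0 := by
  by_cases h : L = 0
  · simp [h, hψ0]
  · rw [if_neg h, ← psi_tot ψ hψadd hψnt]
    exact Fintype.sum_bijective _ (mulRight_bijective₀ L h) _ _ fun x => rfl

theorem psi_ne {F : Type} [Field F] [Fintype F] (ψ : F → ℂ)
    (hψadd : ∀ a b, ψ (a + b) = ψ a * ψ b) (hψ0 : ψ 0 = 1) (hψnt : ∃ a, ψ a ≠ 1) (m : F)
    (hm : m = 0 ∨ m = 1) :
    ∑ a ∈ Finset.univ.filter (fun a : F => a ≠ 0), ψ (a * m) =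
      if m = 1 then (-1 : ℂ) else (Fintype.card F : ℂ) - 1 := by
  have h := psi_lin ψ hψadd hψ0 hψnt m
  rw [← Finset.sum_filter_add_sum_filter_not Finset.univ (fun a : F => a ≠ 0)] at h
  have h2 : Finset.univ.filter (fun a : F => ¬ a ≠ 0) = {0} := by ext; simp
  rw [h2, Finset.sum_singleton, zero_mul, hψ0] at h
  rw [eq_sub_of_add_eq h]
  rcases hm with rfl | rfl <;> simp

theorem psi_supp {F : Type} [Field F] [Fintype F] (ψ : F → ℂ)
    (hψadd : ∀ a b, ψ (a + b) = ψ a * ψ b) (hψ0 : ψ 0 = 1) (hψnt : ∃ a, ψ a ≠ 1)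
    {N : ℕ} (W : Finset (Fin N)) (L : Fin N → F) :
    ∑ w ∈ suppF F W, ψ (∑ s, w s * L s) =
      if ∀ s ∈ W, L s = 0 then (Fintype.card F : ℂ) ^ W.card else 0 := by
  simp_rw [psi_sum ψ hψadd hψ0]
  unfold suppF
  rw [← Finset.prod_univ_sum (fun s => if s ∈ W then Finset.univ else {0})
    (fun s c => ψ (c * L s))]
  have h1 : ∀ s, (∑ c ∈ (if s ∈ W then Finset.univ else {0}), ψ (c * L s)) =
      if s ∈ W then (if L s = 0 then (Fintype.card F : ℂ) else 0) else 1 := by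
    intro s
    by_cases h : s ∈ W
    · simp only [h, if_true]; exact psi_lin ψ hψadd hψ0 hψnt _
    · simp [h, hψ0]
  simp_rw [h1]
  rw [Finset.prod_ite_mem, Finset.univ_inter]
  split_ifs with h
  · rw [Finset.prod_congr rfl (fun s hs => if_pos (h s hs))]; simp
  · push Not at h
    obtain ⟨s, hs, hs'⟩ := h
    exact Finset.prod_eq_zero hs (if_neg hs')

/-- The combinatorial orbit with removed columns `A`. -/
def OA (F : Type) [Field F] {N : ℕ} (P : Fin N → Fin N → Prop) (A : Set (Fin N))
    (S : Finset (Fin N × Fin N)) : Set (Matrix (Fin N) (Fin N) F) :=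
  {Z | ∃ x y : Fin N → Fin N → F, (∀ i, x i i ≠ 0) ∧ (∀ i j, j < i → x i j = 0) ∧
    (∀ k, y k k ≠ 0) ∧ (∀ k s, k < s → y k s = 0) ∧
    Z = fun r s => if P r s ∧ s ∉ A then ∑ p ∈ S, x p.1 r * y p.2 s else 0}

/-- Pairing. -/
def pair {F : Type} [Field F] {N : ℕ} (Z mu : Matrix (Fin N) (Fin N) F) : F :=
  ∑ r, ∑ s, Z r s * mu r s

/-- Partial character sum. -/
def chiS {F : Type} [Field F] [Fintype F] (ψ : F → ℂ) {N : ℕ} (P : Fin N → Fin N → Prop)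
    (A : Set (Fin N)) (S : Finset (Fin N × Fin N)) (mu : Matrix (Fin N) (Fin N) F) : ℂ :=
  ∑ Z ∈ Finset.univ.filter (fun Z => Z ∈ OA F P A S), ψ (pair Z mu)

/-- Row support. -/
def VV {N : ℕ} (P : Fin N → Fin N → Prop) (i k : Fin N) : Finset (Fin N) :=
  Finset.univ.filter (fun j => i < j ∧ P j k)

/-- Column support. -/
def WW {N : ℕ} (P : Fin N → Fin N → Prop) (A : Set (Fin N)) (i k : Fin N) : Finset (Fin N) :=
  Finset.univ.filter (fun s => s < k ∧ P i s ∧ s ∉ A)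

/-- Rank one piece. -/
def piece {F : Type} [Field F] {N : ℕ} (P : Fin N → Fin N → Prop) (A : Set (Fin N))
    (i k : Fin N) (a : F) (v w : Fin N → F) : Matrix (Fin N) (Fin N) F :=
  fun r s => if P r s ∧ s ∉ A then
    ((if r = i then a else 0) + v r) * ((if s = k then 1 else 0) + w s) else 0

/-- One factor. -/
def fac {F : Type} [Field F] [Fintype F] (ψ : F → ℂ) {N : ℕ} (P : Fin N → Fin N → Prop)
    (A : Set (Fin N)) (i k : Fin N) (mu : Matrix (Fin N) (Fin N) F) : ℂ :=
  ∑ a ∈ Finset.univ.filter (fun a : F => a ≠ 0), ∑ v ∈ suppF F (VV P i k),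
    ∑ w ∈ suppF F (WW P A i k), ψ (pair (piece P A i k a v w) mu)

theorem orb_eq (F : Type) [Field F] {N : ℕ} (P : Fin N → Fin N → Prop)
    (lam : Matrix (Fin N) (Fin N) F) (hlam : IsPPM lam) :
    orb F (id : Fin N → Fin N) P lam =
      OA F P ∅ (Finset.univ.filter (fun p : Fin N × Fin N => lam p.1 p.2 = 1)) := by
  have key : ∀ g h : Matrix (Fin N) (Fin N) F, ∀ r s, (g * lam * h) r s =
      ∑ p ∈ Finset.univ.filter (fun p : Fin N × Fin N => lam p.1 p.2 = 1),
        g r p.1 * h p.2 s := by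
    intro g h r s
    rw [Finset.sum_filter, Fintype.sum_prod_type, Finset.sum_comm]
    simp only [Matrix.mul_apply, Finset.sum_mul]
    refine Finset.sum_congr rfl fun b _ => Finset.sum_congr rfl fun a _ => ?_
    rcases hlam.1 a b with h | h <;> simp [h]
  have un : ∀ g : Matrix (Fin N) (Fin N) F, (∀ r s, r < s → g r s = 0) →
      (IsUnit g ↔ ∀ i, g i i ≠ 0) := by
    intro g hg
    rw [Matrix.isUnit_iff_isUnit_det, Matrix.det_of_lowerTriangular g
      (fun a b hab => hg a b hab), isUnit_iff_ne_zero, Finset.prod_ne_zero_iff]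
    simp
  ext Z
  constructor
  · rintro ⟨g, h, hg, hh, hg', hh', rfl⟩
    refine ⟨fun i j => g j i, fun k s => h k s, (un g hg').1 hg, fun i j hij => hg' _ _ hij,
      (un h hh').1 hh, fun i j hij => hh' _ _ hij, ?_⟩
    funext r s
    simp [trunc, key]
  · rintro ⟨x, y, hx, hx', hy, hy', rfl⟩
    refine ⟨fun i j => x j i, y, (un _ fun i j hij => hx' _ _ hij).2 hx,
      (un _ fun i j hij => hy' _ _ hij).2 hy, fun i j hij => hx' _ _ hij,
      fun i j hij => hy' _ _ hij, ?_⟩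
    funext r s
    simp only [trunc, Set.mem_empty_iff_false, not_false_eq_true, and_true]
    split_ifs
    · exact (key (fun i j => x j i) y r s).symm
    · rfl

theorem chi_eq {F : Type} [Field F] [Fintype F] (ψ : F → ℂ) {N : ℕ}
    (P : Fin N → Fin N → Prop) (lam mu : Matrix (Fin N) (Fin N) F) (hlam : IsPPM lam) :
    chi ψ (id : Fin N → Fin N) P lam (1 + mu) = chiS ψ P ∅
      (Finset.univ.filter (fun p : Fin N × Fin N => lam p.1 p.2 = 1)) mu := by
  unfold chi chiS
  rw [orb_eq F P lam hlam, add_sub_cancel_left, Finset.sum_filter, ← finsum_eq_sum_of_fintype]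
  refine finsum_congr fun Z => ?_
  rw [finsum_eq_if]
  rfl

theorem OA_row {F : Type} [Field F] {N : ℕ} {P : Fin N → Fin N → Prop} {A : Set (Fin N)}
    {S : Finset (Fin N × Fin N)} {Z : Matrix (Fin N) (Fin N) F} (hZ : Z ∈ OA F P A S)
    (i : Fin N) (hi : ∀ p ∈ S, i < p.1) (s : Fin N) : Z i s = 0 := by
  obtain ⟨x, y, hx, hx', hy, hy', rfl⟩ := hZ
  simp only
  split_ifs
  · exact Finset.sum_eq_zero fun p hp => by rw [hx' _ _ (hi p hp), zero_mul]
  · rfl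

theorem OA_col {F : Type} [Field F] {N : ℕ} {P : Fin N → Fin N → Prop} {A : Set (Fin N)}
    {S : Finset (Fin N × Fin N)} {Z : Matrix (Fin N) (Fin N) F} (hZ : Z ∈ OA F P A S)
    (k : Fin N) (hk : k ∈ A) (s : Fin N) : Z s k = 0 := by
  obtain ⟨x, y, hx, hx', hy, hy', rfl⟩ := hZ
  simp [hk]

theorem mem_VV {N : ℕ} {P : Fin N → Fin N → Prop} {i k j : Fin N} :
    j ∈ VV P i k ↔ i < j ∧ P j k := by simp [VV]

theorem mem_WW {N : ℕ} {P : Fin N → Fin N → Prop} {A : Set (Fin N)} {i k j : Fin N} :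
    j ∈ WW P A i k ↔ j < k ∧ P i j ∧ j ∉ A := by simp [WW]

theorem step_into {F : Type} [Field F] [Fintype F] {N : ℕ} {P : Fin N → Fin N → Prop}
    {A : Set (Fin N)} {S : Finset (Fin N × Fin N)} {i k : Fin N}
    (hik : (i, k) ∉ S) (hcol : ∀ p ∈ S, p.2 ≠ k) (hrow : ∀ p ∈ S, i < p.1) (hkA : k ∉ A)
    {a : F} {v w : Fin N → F} (ha : a ≠ 0) (hv : v ∈ suppF F (VV P i k))
    (hw : w ∈ suppF F (WW P A i k)) {Z : Matrix (Fin N) (Fin N) F}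
    (hZ : Z ∈ OA F P (insert k A) S) :
    piece P A i k a v w + Z ∈ OA F P A (insert (i, k) S) := by
  rw [mem_suppF] at hv hw
  obtain ⟨x, y, hx, hx', hy, hy', rfl⟩ := hZ
  have hv0 : ∀ j, j ≤ i → v j = 0 := fun j hj => hv j (by rw [mem_VV]; intro h; exact absurd h.1 (not_lt.2 hj))
  have hw0 : ∀ j, k ≤ j → w j = 0 := fun j hj => hw j (by rw [mem_WW]; intro h; exact absurd h.1 (not_lt.2 hj))
  refine ⟨fun i' r => if i' = i then (if r = i then a else 0) + v r else x i' r,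
    fun k' s => if k' = k then (if s = k then 1 else 0) + w s else
      if s = k then 0 else y k' s, ?_, ?_, ?_, ?_, ?_⟩
  · intro j
    by_cases h : j = i
    · subst h; simp [hv0 j le_rfl, ha]
    · simp [h, hx]
  · intro j r hr
    by_cases h : j = i
    · subst h; simp [hv0 r hr.le, hr.ne]
    · simp [h, hx' _ _ hr]
  · intro j
    by_cases h : j = k
    · subst h; simp [hw0 j le_rfl]
    · simp [h, hy]
  · intro j r hr
    by_cases h : j = k
    · subst h; simp [hw0 r hr.le, hr.ne']
    · simp [h, hy' _ _ hr]
  · funext r s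
    rw [Finset.sum_insert hik]
    refine (Matrix.add_apply (piece P A i k a v w) _ r s).trans ?_
    simp only [piece, if_true]
    by_cases h : P r s ∧ s ∉ A
    · rw [if_pos h, if_pos h]
      congr 1
      by_cases hs : s = k
      · subst hs
        rw [if_neg (by simp)]
        refine (Finset.sum_eq_zero fun p hp => ?_).symm
        simp [hcol p hp]
      · rw [if_pos ⟨h.1, by simp [hs, h.2]⟩]
        refine Finset.sum_congr rfl fun p hp => ?_
        simp [hcol p hp, hs, (hrow p hp).ne']
    · rw [if_neg h, if_neg h, if_neg, add_zero]
      rintro ⟨h1, h2⟩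
      exact h ⟨h1, fun h3 => h2 (Set.mem_insert_of_mem _ h3)⟩

theorem step_surj {F : Type} [Field F] [Fintype F] {N : ℕ} {P : Fin N → Fin N → Prop}
    (hP : IsNormalChainSubposet P)
    {A : Set (Fin N)} {S : Finset (Fin N × Fin N)} {i k : Fin N}
    (hik : (i, k) ∉ S) (hcol : ∀ p ∈ S, p.2 ≠ k) (hrow : ∀ p ∈ S, i < p.1)
    {Z : Matrix (Fin N) (Fin N) F}
    (hZ : Z ∈ OA F P A (insert (i, k) S)) :
    ∃ a : F, ∃ v w : Fin N → F, ∃ Z', a ≠ 0 ∧ v ∈ suppF F (VV P i k) ∧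
      w ∈ suppF F (WW P A i k) ∧ Z' ∈ OA F P (insert k A) S ∧
      Z = piece P A i k a v w + Z' := by
  obtain ⟨x, y, hx, hx', hy, hy', rfl⟩ := hZ
  obtain ⟨e, he⟩ : ∃ e : Fin N → F, e = fun s => y k s / y k k := ⟨_, rfl⟩
  have hek : e k = 1 := by rw [he]; exact div_self (hy k)
  have he0 : ∀ s, k < s → e s = 0 := fun s hs => by rw [he]; simp [hy' _ _ hs]
  obtain ⟨X, hX⟩ : ∃ X : Fin N → F, X = fun r => y k k * x i r + ∑ p ∈ S, y p.2 k * x p.1 r :=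
    ⟨_, rfl⟩
  have hXi : X i ≠ 0 := by
    rw [hX]
    simp only
    rw [Finset.sum_eq_zero (fun p hp => by rw [hx' _ _ (hrow p hp), mul_zero]), add_zero]
    exact mul_ne_zero (hy k) (hx i)
  have hX0 : ∀ r, r < i → X r = 0 := by
    intro r hr
    rw [hX]
    simp only
    rw [Finset.sum_eq_zero (fun p hp => by rw [hx' _ _ (hr.trans (hrow p hp)), mul_zero]),
      hx' _ _ hr]
    simp
  obtain ⟨yh, hyh⟩ : ∃ yh : Fin N → Fin N → F,
      yh = fun k' s => y k' s - if k' = k then 0 else y k' k * e s := ⟨_, rfl⟩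
  refine ⟨X i, fun r => if r ∈ VV P i k then X r else 0,
    fun s => if s ∈ WW P A i k then e s else 0,
    fun r s => if P r s ∧ s ∉ insert k A then ∑ p ∈ S, x p.1 r * yh p.2 s else 0,
    hXi, ?_, ?_, ?_, ?_⟩
  · rw [mem_suppF]; intro s hs; simp [hs]
  · rw [mem_suppF]; intro s hs; simp [hs]
  · refine ⟨x, yh, hx, hx', ?_, ?_, by funext r s; congr⟩
    all_goals rw [hyh]
    · intro k'
      by_cases h : k' = k
      · simp [h, hy]
      · rcases lt_or_gt_of_ne h with h1 | h1
        · simp [h, hy, hy' _ _ h1]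
        · simp [h, hy, he0 _ h1]
    · intro k' s hs
      by_cases h : k' = k
      · subst h; simp [hy' _ _ hs]
      · rcases lt_or_gt_of_ne h with h1 | h1
        · simp [h, hy' _ _ hs, hy' _ _ h1]
        · simp [h, hy' _ _ hs, he0 _ (h1.trans hs)]
  · funext r s
    rw [Finset.sum_insert hik]
    refine Eq.trans ?_ (Matrix.add_apply (piece P A i k (X i) _ _) _ r s).symm
    simp only [piece]
    by_cases h : P r s ∧ s ∉ A
    · rw [if_pos h, if_pos h]
      have e1 : (((if r = i then X i else 0) + if r ∈ VV P i k then X r else 0) *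
          ((if s = k then 1 else 0) + if s ∈ WW P A i k then e s else 0)) = X r * e s := by
        rcases lt_trichotomy k s with hs | hs | hs
        · have hn : s ∉ WW P A i k := by rw [mem_WW]; intro h; exact absurd h.1 (not_lt.2 hs.le)
          simp [he0 s hs, hs.ne', hn]
        · subst hs
          have hn : k ∉ WW P A i k := by rw [mem_WW]; intro h; exact absurd h.1 (lt_irrefl _)
          rw [if_neg hn, hek]
          rcases lt_trichotomy r i with hr | hr | hr
          · simp [hr.ne, hX0 r hr]
          · subst hr; simp [mem_VV]
          · simp [hr.ne', mem_VV, hr, h.1]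
        · have hrk : P r k := hP.2.2 _ _ _ h.1 hs
          rcases lt_trichotomy r i with hr | hr | hr
          · simp [hr.ne, hX0 r hr]
          · subst hr; simp [mem_VV, mem_WW, hs, hs.ne, h.1, h.2]
          · have his : P i s := hP.2.1 _ _ _ h.1 hr
            simp [hr.ne', mem_VV, mem_WW, hs, hs.ne, hr, hrk, his, h.2]
      rw [e1]
      have e2 : (if P r s ∧ s ∉ insert k A then ∑ p ∈ S, x p.1 r * yh p.2 s else 0) =
          ∑ p ∈ S, x p.1 r * (y p.2 s - y p.2 k * e s) := by
        by_cases hs : s = k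
        · subst hs
          rw [if_neg (by simp), hek]
          simp
        · rw [if_pos ⟨h.1, by simp [hs, h.2]⟩]
          exact Finset.sum_congr rfl fun p hp => by rw [hyh]; simp only; rw [if_neg (hcol p hp)]
      rw [e2, hX]
      simp only [add_mul, Finset.sum_mul, add_assoc, ← Finset.sum_add_distrib]
      congr 1
      · rw [he]; field_simp [hy k]
      · exact Finset.sum_congr rfl fun p hp => by ring
    · rw [if_neg h, if_neg h, if_neg, add_zero]
      rintro ⟨h1, h2⟩
      exact h ⟨h1, fun h3 => h2 (Set.mem_insert_of_mem _ h3)⟩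

theorem step_inj {F : Type} [Field F] [Fintype F] {N : ℕ} {P : Fin N → Fin N → Prop}
    {A : Set (Fin N)} {S : Finset (Fin N × Fin N)} {i k : Fin N} (hPik : P i k)
    (hrow : ∀ p ∈ S, i < p.1) (hkA : k ∉ A)
    {a a' : F} {v w v' w' : Fin N → F} (ha : a ≠ 0) (hv : v ∈ suppF F (VV P i k))
    (hw : w ∈ suppF F (WW P A i k)) {Z Z' : Matrix (Fin N) (Fin N) F}
    (hZ : Z ∈ OA F P (insert k A) S) (hv' : v' ∈ suppF F (VV P i k))
    (hw' : w' ∈ suppF F (WW P A i k))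
    (hZ' : Z' ∈ OA F P (insert k A) S)
    (h : piece P A i k a v w + Z = piece P A i k a' v' w' + Z') :
    a = a' ∧ v = v' ∧ w = w' ∧ Z = Z' := by
  rw [mem_suppF] at hv hw hv' hw'
  have vi : i ∉ VV P i k := by simp [mem_VV]
  have wk : k ∉ WW P A i k := by simp [mem_WW]
  have e : ∀ r s, piece P A i k a v w r s + Z r s = piece P A i k a' v' w' r s + Z' r s :=
    fun r s => congrFun (congrFun h r) s
  have ea : a = a' := by
    have := e i k
    simpa [piece, OA_row hZ i hrow, OA_row hZ' i hrow, hPik, hkA, hv i vi, hv' i vi, hw k wk,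
      hw' k wk] using this
  subst ea
  have ev : v = v' := by
    funext j
    by_cases hj : j ∈ VV P i k
    · have := e j k
      rw [mem_VV] at hj
      simpa [piece, OA_col hZ k (Set.mem_insert _ _), OA_col hZ' k (Set.mem_insert _ _), hj.2,
        hkA, hj.1.ne', hw k wk, hw' k wk] using this
    · rw [hv j hj, hv' j hj]
  subst ev
  have ew : w = w' := by
    funext j
    by_cases hj : j ∈ WW P A i k
    · have := e i j
      rw [mem_WW] at hj
      simpa [piece, OA_row hZ i hrow, OA_row hZ' i hrow, hj.1.ne, hj.2.1, hj.2.2, ha,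
        hv i vi] using this
    · rw [hw j hj, hw' j hj]
  subst ew
  exact ⟨rfl, rfl, rfl, add_left_cancel h⟩

theorem chiS_step {F : Type} [Field F] [Fintype F] (ψ : F → ℂ)
    (hψadd : ∀ a b, ψ (a + b) = ψ a * ψ b) {N : ℕ} {P : Fin N → Fin N → Prop}
    (hP : IsNormalChainSubposet P)
    {A : Set (Fin N)} {S : Finset (Fin N × Fin N)} {i k : Fin N} (hPik : P i k)
    (hik : (i, k) ∉ S) (hcol : ∀ p ∈ S, p.2 ≠ k) (hrow : ∀ p ∈ S, i < p.1) (hkA : k ∉ A)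
    (mu : Matrix (Fin N) (Fin N) F) :
    chiS ψ P A (insert (i, k) S) mu = fac ψ P A i k mu * chiS ψ P (insert k A) S mu := by
  unfold chiS fac
  rw [Finset.sum_mul]
  simp_rw [Finset.sum_mul, Finset.mul_sum]
  simp_rw [← Finset.sum_product']
  symm
  refine Finset.sum_bij (fun t _ => piece P A i k t.1 t.2.1 t.2.2.1 + t.2.2.2) ?_ ?_ ?_ ?_
  · rintro ⟨a, v, w, Z⟩ ht
    simp only [Finset.mem_product, Finset.mem_filter, Finset.mem_univ, true_and] at ht ⊢
    exact step_into hik hcol hrow hkA ht.1 ht.2.1 ht.2.2.1 ht.2.2.2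
  · rintro ⟨a, v, w, Z⟩ ht ⟨a', v', w', Z'⟩ ht' h
    simp only [Finset.mem_product, Finset.mem_filter, Finset.mem_univ, true_and] at ht ht' h
    obtain ⟨h1, h2, h3, h4⟩ := step_inj hPik hrow hkA ht.1 ht.2.1 ht.2.2.1 ht.2.2.2 ht'.2.1
      ht'.2.2.1 ht'.2.2.2 h
    rw [h1, h2, h3, h4]
  · intro Z hZ
    simp only [Finset.mem_filter, Finset.mem_univ, true_and] at hZ
    obtain ⟨a, v, w, Z', h1, h2, h3, h4, h5⟩ := step_surj hP hik hcol hrow hZ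
    refine ⟨(a, v, w, Z'), ?_, h5.symm⟩
    simp only [Finset.mem_product, Finset.mem_filter, Finset.mem_univ, true_and]
    exact ⟨h1, h2, h3, h4⟩
  · rintro ⟨a, v, w, Z⟩ ht
    rw [← hψadd]
    simp only [pair, Matrix.add_apply, add_mul, Finset.sum_add_distrib]

theorem chiS_prod {F : Type} [Field F] [Fintype F] (ψ : F → ℂ)
    (hψadd : ∀ a b, ψ (a + b) = ψ a * ψ b) (hψ0 : ψ 0 = 1) {N : ℕ} {P : Fin N → Fin N → Prop}
    (hP : IsNormalChainSubposet P) (mu : Matrix (Fin N) (Fin N) F) (n : ℕ) :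
    ∀ (A : Set (Fin N)) (S : Finset (Fin N × Fin N)), S.card = n → (∀ p ∈ S, P p.1 p.2) →
    (∀ p ∈ S, p.2 ∉ A) → (∀ p ∈ S, ∀ p' ∈ S, p.1 = p'.1 → p = p') →
    (∀ p ∈ S, ∀ p' ∈ S, p.2 = p'.2 → p = p') →
    chiS ψ P A S mu =
      ∏ p ∈ S, fac ψ P (A ∪ {s | ∃ i', i' < p.1 ∧ (i', s) ∈ S}) p.1 p.2 mu := by
  induction n with
  | zero =>
    intro A S hS _ _ _ _
    rw [Finset.card_eq_zero] at hS
    subst hS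
    have : (Finset.univ.filter (fun Z => Z ∈ OA F P A (∅ : Finset (Fin N × Fin N)))) = {0} := by
      ext Z
      simp only [Finset.mem_filter, Finset.mem_univ, true_and, Finset.mem_singleton]
      constructor
      · rintro ⟨x, y, -, -, -, -, rfl⟩
        funext r s
        simp
      · rintro rfl
        refine ⟨fun i j => if i = j then 1 else 0, fun i j => if i = j then 1 else 0, by simp,
          fun i j h => by simp [h.ne'], by simp, fun i j h => by simp [h.ne], ?_⟩
        funext r s
        simp
    rw [chiS, this]
    simp [pair, hψ0]
  | succ n ih =>
    intro A S hS hSP hSA hr hc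
    have hne : S.Nonempty := by rw [← Finset.card_pos]; omega
    obtain ⟨p0, hp0, hmin⟩ := S.exists_min_image (fun p => p.1) hne
    obtain ⟨i, k⟩ := p0
    obtain ⟨S', hS', rfl⟩ : ∃ S', (i, k) ∉ S' ∧ insert (i, k) S' = S :=
      ⟨S.erase (i, k), Finset.notMem_erase _ _, Finset.insert_erase hp0⟩
    have hrow : ∀ p ∈ S', i < p.1 := by
      intro p hp
      refine lt_of_le_of_ne (hmin p (Finset.mem_insert_of_mem hp)) fun h => ?_
      exact hS' (hr _ hp0 _ (Finset.mem_insert_of_mem hp) h ▸ hp)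
    have hcol : ∀ p ∈ S', p.2 ≠ k := by
      intro p hp h
      exact hS' (hc _ hp0 _ (Finset.mem_insert_of_mem hp) h.symm ▸ hp)
    rw [chiS_step ψ hψadd hP (hSP _ hp0) hS' hcol hrow (hSA _ hp0), Finset.prod_insert hS']
    refine congrArg₂ (· * ·) ?_ ?_
    · refine congrArg (fun B => fac ψ P B i k mu) ?_
      ext s
      simp only [Set.mem_union, Set.mem_ofPred_eq, iff_self_or]
      rintro ⟨i', h1, h2⟩
      exact absurd (hmin _ h2) (not_le.2 h1)
    · rw [ih (insert k A) S' (by rw [Finset.card_insert_of_notMem hS'] at hS; omega)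
        (fun p hp => hSP p (Finset.mem_insert_of_mem hp))
        (fun p hp => by
          simp only [Set.mem_insert_iff, not_or]
          exact ⟨hcol p hp, hSA p (Finset.mem_insert_of_mem hp)⟩)
        (fun p hp p' hp' => hr p (Finset.mem_insert_of_mem hp) p' (Finset.mem_insert_of_mem hp'))
        (fun p hp p' hp' => hc p (Finset.mem_insert_of_mem hp) p' (Finset.mem_insert_of_mem hp'))]
      refine Finset.prod_congr rfl fun p hp => ?_
      refine congrArg (fun B => fac ψ P B p.1 p.2 mu) ?_
      ext s
      simp only [Set.mem_union, Set.mem_ofPred_eq, Set.mem_insert_iff, Finset.mem_insert,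
        Prod.mk.injEq]
      constructor
      · rintro ((rfl | h) | ⟨i', h1, h2⟩)
        · exact Or.inr ⟨i, hrow p hp, Or.inl ⟨rfl, rfl⟩⟩
        · exact Or.inl h
        · exact Or.inr ⟨i', h1, Or.inr h2⟩
      · rintro (h | ⟨i', h1, ⟨rfl, rfl⟩ | h2⟩)
        · exact Or.inl (Or.inr h)
        · exact Or.inl (Or.inl rfl)
        · exact Or.inr ⟨i', h1, h2⟩

theorem pair_piece {F : Type} [Field F] [Fintype F] {N : ℕ} {P : Fin N → Fin N → Prop}
    {A : Set (Fin N)} {i k : Fin N} (hkA : k ∉ A) (a : F) (v w : Fin N → F)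
    (hw : w ∈ suppF F (WW P A i k)) (mu : Matrix (Fin N) (Fin N) F)
    (hmu' : ∀ i j : Fin N, ¬ P i j → mu i j = 0) :
    pair (piece P A i k a v w) mu = (a * mu i k + ∑ r, v r * mu r k) +
      ∑ s, w s * (a * mu i s + ∑ r, v r * mu r s) := by
  rw [mem_suppF] at hw
  have e : ∀ r s, piece P A i k a v w r s * mu r s =
      ((if r = i then a else 0) + v r) * ((if s = k then 1 else 0) + w s) * mu r s := by
    intro r s
    unfold piece
    by_cases hp : P r s
    · by_cases hs : s ∈ A
      · have h1 : s ≠ k := fun h => hkA (h ▸ hs)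
        have h2 : w s = 0 := hw s (by rw [mem_WW]; tauto)
        simp [hs, h1, h2]
      · simp [hp, hs]
    · simp [hmu' r s hp]
  have L : ∀ s, ∑ r, ((if r = i then a else 0) + v r) * mu r s =
      a * mu i s + ∑ r, v r * mu r s := by
    intro s
    simp only [add_mul, Finset.sum_add_distrib]
    simp
  unfold pair
  simp_rw [e]
  rw [Finset.sum_comm]
  have e2 : ∀ s, ∑ r, ((if r = i then a else 0) + v r) * ((if s = k then 1 else 0) + w s) * mu r s
      = (if s = k then 1 else 0) * (a * mu i s + ∑ r, v r * mu r s) +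
        w s * (a * mu i s + ∑ r, v r * mu r s) := by
    intro s
    rw [← L s, ← add_mul, Finset.mul_sum]
    exact Finset.sum_congr rfl fun r _ => by ring
  simp_rw [e2]
  rw [Finset.sum_add_distrib]
  simp

/-- Rows killed by nesting. -/
def MM {F : Type} [Field F] {N : ℕ} (P : Fin N → Fin N → Prop) (A : Set (Fin N))
    (i k : Fin N) (mu : Matrix (Fin N) (Fin N) F) : Finset (Fin N) :=
  Finset.univ.filter (fun r => r ∈ VV P i k ∧ ∃ s ∈ WW P A i k, mu r s = 1)

theorem mem_MM {F : Type} [Field F] {N : ℕ} {P : Fin N → Fin N → Prop} {A : Set (Fin N)}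
    {i k : Fin N} {mu : Matrix (Fin N) (Fin N) F} {r : Fin N} :
    r ∈ MM P A i k mu ↔ r ∈ VV P i k ∧ ∃ s ∈ WW P A i k, mu r s = 1 := by simp [MM]

theorem fac_bad1 {F : Type} [Field F] [Fintype F] (ψ : F → ℂ)
    (hψadd : ∀ a b, ψ (a + b) = ψ a * ψ b) (hψ0 : ψ 0 = 1) (hψnt : ∃ a, ψ a ≠ 1)
    {N : ℕ} {P : Fin N → Fin N → Prop}
    {A : Set (Fin N)} {i k : Fin N} (hkA : k ∉ A) (mu : Matrix (Fin N) (Fin N) F)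
    (hmu : IsPPM mu) (hmu' : ∀ i j : Fin N, ¬ P i j → mu i j = 0)
    (hb : ∃ s ∈ WW P A i k, mu i s = 1) : fac ψ P A i k mu = 0 := by
  unfold fac
  refine Finset.sum_eq_zero fun a ha => Finset.sum_eq_zero fun v hv => ?_
  rw [Finset.sum_congr rfl fun w hw => by rw [pair_piece hkA a v w hw mu hmu', hψadd],
    ← Finset.mul_sum, psi_supp ψ hψadd hψ0 hψnt, if_neg, mul_zero]
  intro h
  obtain ⟨s, hs, hs1⟩ := hb
  have h1 := h s hs
  rw [mem_suppF] at hv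
  rw [Finset.sum_eq_zero, add_zero, hs1, mul_one] at h1
  · exact (Finset.mem_filter.1 ha).2 h1
  · intro r _
    by_cases hr : r = i
    · rw [hv r (by rw [hr, mem_VV]; exact fun h => lt_irrefl _ h.1), zero_mul]
    · by_cases h0 : mu r s = 0
      · rw [h0, mul_zero]
      · exact absurd (hmu.2.2 r i s h0 (by rw [hs1]; exact one_ne_zero)) hr

theorem fac_form {F : Type} [Field F] [Fintype F] (ψ : F → ℂ)
    (hψadd : ∀ a b, ψ (a + b) = ψ a * ψ b) (hψ0 : ψ 0 = 1) (hψnt : ∃ a, ψ a ≠ 1)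
    {N : ℕ} {P : Fin N → Fin N → Prop}
    {A : Set (Fin N)} {i k : Fin N} (hkA : k ∉ A) (mu : Matrix (Fin N) (Fin N) F)
    (hmu : IsPPM mu) (hmu' : ∀ i j : Fin N, ¬ P i j → mu i j = 0)
    (hb : ¬ ∃ s ∈ WW P A i k, mu i s = 1) : fac ψ P A i k mu =
      (if mu i k = 1 then (-1 : ℂ) else (Fintype.card F : ℂ) - 1) *
      ((if ∀ r ∈ VV P i k \ MM P A i k mu, mu r k = 0 then
        (Fintype.card F : ℂ) ^ (VV P i k \ MM P A i k mu).card else 0) *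
        (Fintype.card F : ℂ) ^ (WW P A i k).card) := by
  rw [← psi_ne ψ hψadd hψ0 hψnt _ (hmu.1 i k), Finset.sum_mul]
  unfold fac
  refine Finset.sum_congr rfl fun a ha => ?_
  have h1 : ∀ v ∈ suppF F (VV P i k),
      ∑ w ∈ suppF F (WW P A i k), ψ (pair (piece P A i k a v w) mu) =
      if v ∈ suppF F (VV P i k \ MM P A i k mu) then
        ψ (a * mu i k + ∑ r, v r * mu r k) * (Fintype.card F : ℂ) ^ (WW P A i k).card
      else 0 := by
    intro v hv
    rw [Finset.sum_congr rfl fun w hw => by rw [pair_piece hkA a v w hw mu hmu', hψadd],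
      ← Finset.mul_sum, psi_supp ψ hψadd hψ0 hψnt, mul_ite, mul_zero]
    refine if_congr ?_ rfl rfl
    rw [mem_suppF] at hv ⊢
    constructor
    · intro h r hr
      by_cases hr1 : r ∈ VV P i k
      · have hrM : r ∈ MM P A i k mu := by
          by_contra h2
          exact hr (Finset.mem_sdiff.2 ⟨hr1, h2⟩)
        obtain ⟨-, s, hs, hrs⟩ := mem_MM.1 hrM
        have h3 := h s hs
        have h4 : mu i s = 0 := (hmu.1 i s).resolve_right fun h5 => hb ⟨s, hs, h5⟩
        rw [h4, mul_zero, zero_add, Finset.sum_eq_single r, hrs, mul_one] at h3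
        · exact h3
        · intro r' _ hr'
          by_cases h0 : mu r' s = 0
          · rw [h0, mul_zero]
          · exact absurd (hmu.2.2 r' r s h0 (by rw [hrs]; exact one_ne_zero)) hr'
        · simp
      · exact hv r hr1
    · intro h s hs
      have h4 : mu i s = 0 := (hmu.1 i s).resolve_right fun h5 => hb ⟨s, hs, h5⟩
      rw [h4, mul_zero, zero_add]
      refine Finset.sum_eq_zero fun r _ => ?_
      rcases hmu.1 r s with h0 | h0
      · rw [h0, mul_zero]
      · rw [h r, zero_mul]
        intro h5
        rw [Finset.mem_sdiff] at h5
        exact h5.2 (mem_MM.2 ⟨h5.1, s, hs, h0⟩)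
  rw [Finset.sum_congr rfl h1, ← Finset.sum_filter]
  have h2 : (suppF F (VV P i k)).filter (fun v => v ∈ suppF F (VV P i k \ MM P A i k mu)) =
      suppF F (VV P i k \ MM P A i k mu) := by
    ext v
    simp only [Finset.mem_filter, and_iff_right_iff_imp, mem_suppF]
    intro h s hs
    exact h s fun h3 => hs (Finset.mem_sdiff.1 h3).1
  rw [h2, ← Finset.sum_mul]
  simp_rw [hψadd]
  rw [← Finset.mul_sum, psi_supp ψ hψadd hψ0 hψnt, mul_assoc]

theorem fac_bad2 {F : Type} [Field F] [Fintype F] (ψ : F → ℂ)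
    (hψadd : ∀ a b, ψ (a + b) = ψ a * ψ b) (hψ0 : ψ 0 = 1) (hψnt : ∃ a, ψ a ≠ 1)
    {N : ℕ} {P : Fin N → Fin N → Prop}
    {A : Set (Fin N)} {i k : Fin N} (hkA : k ∉ A) (mu : Matrix (Fin N) (Fin N) F)
    (hmu : IsPPM mu) (hmu' : ∀ i j : Fin N, ¬ P i j → mu i j = 0)
    (r : Fin N) (hir : i < r) (hr : mu r k = 1) : fac ψ P A i k mu = 0 := by
  by_cases hb : ∃ s ∈ WW P A i k, mu i s = 1
  · exact fac_bad1 ψ hψadd hψ0 hψnt hkA mu hmu hmu' hb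
  · suffices hn : ¬ ∀ r ∈ VV P i k \ MM P A i k mu, mu r k = 0 by
      rw [fac_form ψ hψadd hψ0 hψnt hkA mu hmu hmu' hb, if_neg hn, zero_mul, mul_zero]
    intro h
    have hP : P r k := by
      by_contra h1
      rw [hmu' r k h1] at hr
      exact zero_ne_one hr
    have := h r (Finset.mem_sdiff.2 ⟨mem_VV.2 ⟨hir, hP⟩, ?_⟩)
    · rw [hr] at this; exact one_ne_zero this
    · intro h2
      obtain ⟨-, s, hs, h3⟩ := mem_MM.1 h2
      have h4 := hmu.2.1 r s k (by rw [h3]; exact one_ne_zero) (by rw [hr]; exact one_ne_zero)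
      rw [mem_WW] at hs
      exact absurd hs.1 (by rw [h4]; exact lt_irrefl _)

theorem stmt_11 (F : Type) [Field F] [Fintype F] (ψ : F → ℂ)
    (hψadd : ∀ a b, ψ (a + b) = ψ a * ψ b) (hψ0 : ψ 0 = 1) (hψnt : ∃ a, ψ a ≠ 1)
    (N : ℕ) (P : Fin N → Fin N → Prop) (hP : IsNormalChainSubposet P)
    (lam mu : Matrix (Fin N) (Fin N) F)
    (hlam : IsPPM lam) (hlam' : ∀ i j : Fin N, ¬ P i j → lam i j = 0)
    (hmu : IsPPM mu) (hmu' : ∀ i j : Fin N, ¬ P i j → mu i j = 0) :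
    ((∃ i j k : Fin N, i < j ∧ j < k ∧
        ((lam i k = 1 ∧ mu i j = 1) ∨ (lam i k = 1 ∧ mu j k = 1))) →
      chi ψ (id : Fin N → Fin N) P lam (1 + mu) = 0) ∧
    (¬ (∃ i j k : Fin N, i < j ∧ j < k ∧
        ((lam i k = 1 ∧ mu i j = 1) ∨ (lam i k = 1 ∧ mu j k = 1))) →
      chi ψ (id : Fin N → Fin N) P lam (1 + mu) =
        (-1 : ℂ) ^ pInter lam mu *
          ((Fintype.card F : ℂ) - 1) ^ (pSize lam - pInter lam mu) *
          (Fintype.card F : ℂ) ^ (pDimL P lam + pDimR P lam) /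
          ((Fintype.card F : ℂ) ^ pCrs P lam * (Fintype.card F : ℂ) ^ pNst lam mu)) := by
  have hlamP : ∀ i k, lam i k = 1 → P i k := by
    intro i k h
    by_contra h1
    rw [hlam' i k h1] at h
    exact zero_ne_one h
  have hmuP : ∀ i k, mu i k = 1 → P i k := by
    intro i k h
    by_contra h1
    rw [hmu' i k h1] at h
    exact zero_ne_one h
  have lrow : ∀ r s t, lam r s = 1 → lam r t = 1 → s = t := fun r s t h1 h2 =>
    hlam.2.1 r s t (by rw [h1]; exact one_ne_zero) (by rw [h2]; exact one_ne_zero)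
  have lcol : ∀ r s t, lam r t = 1 → lam s t = 1 → r = s := fun r s t h1 h2 =>
    hlam.2.2 r s t (by rw [h1]; exact one_ne_zero) (by rw [h2]; exact one_ne_zero)
  have mrow : ∀ r s t, mu r s = 1 → mu r t = 1 → s = t := fun r s t h1 h2 =>
    hmu.2.1 r s t (by rw [h1]; exact one_ne_zero) (by rw [h2]; exact one_ne_zero)
  rw [chi_eq ψ P lam mu hlam]
  obtain ⟨S, hSdef⟩ : ∃ S, S = Finset.univ.filter (fun p : Fin N × Fin N => lam p.1 p.2 = 1) :=
    ⟨_, rfl⟩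
  have hS : ∀ p, p ∈ S ↔ lam p.1 p.2 = 1 := by intro p; rw [hSdef]; simp
  rw [← hSdef, chiS_prod ψ hψadd hψ0 hP mu S.card ∅ S rfl
    (fun p hp => hlamP _ _ ((hS p).1 hp)) (fun p _ => Set.notMem_empty _)
    (fun p hp p' hp' h => Prod.ext h (lrow p.1 _ _ ((hS p).1 hp) (h ▸ (hS p').1 hp')))
    (fun p hp p' hp' h => Prod.ext (lcol _ _ p.2 ((hS p).1 hp) (h ▸ (hS p').1 hp')) h)]
  obtain ⟨B, hB⟩ : ∃ B : Fin N × Fin N → Set (Fin N),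
      B = fun p => ∅ ∪ {s | ∃ i', i' < p.1 ∧ (i', s) ∈ S} := ⟨_, rfl⟩
  have hBm : ∀ p s, s ∈ B p ↔ ∃ i', i' < p.1 ∧ lam i' s = 1 := by
    intro p s; rw [hB]; simp [hS]
  have hprod : ∏ p ∈ S, fac ψ P (∅ ∪ {s | ∃ i', i' < p.1 ∧ (i', s) ∈ S}) p.1 p.2 mu =
      ∏ p ∈ S, fac ψ P (B p) p.1 p.2 mu := by rw [hB]
  rw [hprod]
  have hkB : ∀ p ∈ S, p.2 ∉ B p := by
    intro p hp h
    obtain ⟨i', h1, h2⟩ := (hBm _ _).1 h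
    exact h1.ne (lcol _ _ _ h2 ((hS p).1 hp))
  constructor
  · intro hbad
    by_cases h2 : ∃ i j k : Fin N, i < j ∧ lam i k = 1 ∧ mu j k = 1
    · obtain ⟨i, j, k, hij, h3, h4⟩ := h2
      have hm : (i, k) ∈ S := (hS _).2 h3
      exact Finset.prod_eq_zero hm
        (fac_bad2 ψ hψadd hψ0 hψnt (hkB _ hm) mu hmu hmu' j hij h4)
    · obtain ⟨i, j, k, hij, hjk, h | h⟩ := hbad
      · have hm : (i, k) ∈ S := (hS _).2 h.1
        refine Finset.prod_eq_zero hm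
          (fac_bad1 ψ hψadd hψ0 hψnt (hkB _ hm) mu hmu hmu' ⟨j, mem_WW.2 ⟨hjk, hmuP _ _ h.2, ?_⟩, h.2⟩)
        intro h5
        obtain ⟨i', h6, h7⟩ := (hBm _ _).1 h5
        exact h2 ⟨i', i, j, h6, h7, h.2⟩
      · exact absurd ⟨i, j, k, hij, h.1, h.2⟩ h2
  · intro hgood
    have g1 : ∀ i j k, j < k → lam i k = 1 → mu i j = 1 → False := fun i j k h1 h2 h3 =>
      hgood ⟨i, j, k, hP.1.2 _ _ (hmuP _ _ h3), h1, Or.inl ⟨h2, h3⟩⟩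
    have g2 : ∀ i j k, i < j → lam i k = 1 → mu j k = 1 → False := fun i j k h1 h2 h3 =>
      hgood ⟨i, j, k, h1, hP.1.2 _ _ (hmuP _ _ h3), Or.inr ⟨h2, h3⟩⟩
    have hq : (Fintype.card F : ℂ) ≠ 0 := Nat.cast_ne_zero.2 Fintype.card_ne_zero
    have hfac : ∀ p ∈ S, fac ψ P (B p) p.1 p.2 mu =
        (if mu p.1 p.2 = 1 then (-1 : ℂ) else (Fintype.card F : ℂ) - 1) *
        (Fintype.card F : ℂ) ^ ((VV P p.1 p.2 \ MM P (B p) p.1 p.2 mu).card +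
          (WW P (B p) p.1 p.2).card) := by
      intro p hp
      have n1 : ∀ r ∈ VV P p.1 p.2 \ MM P (B p) p.1 p.2 mu, mu r p.2 = 0 := by
        intro r hr
        rw [Finset.mem_sdiff, mem_VV] at hr
        exact (hmu.1 _ _).resolve_right fun h => g2 _ _ _ hr.1.1 ((hS p).1 hp) h
      have n2 : ¬ ∃ s ∈ WW P (B p) p.1 p.2, mu p.1 s = 1 := by
        rintro ⟨s, hs, h⟩
        exact g1 _ _ _ (mem_WW.1 hs).1 ((hS p).1 hp) h
      rw [fac_form ψ hψadd hψ0 hψnt (hkB p hp) mu hmu hmu' n2, if_pos n1, pow_add]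
    rw [Finset.prod_congr rfl hfac, Finset.prod_mul_distrib, Finset.prod_pow_eq_pow_sum,
      Finset.sum_add_distrib]
    have heps : ∏ p ∈ S, (if mu p.1 p.2 = 1 then (-1 : ℂ) else (Fintype.card F : ℂ) - 1) =
        (-1 : ℂ) ^ pInter lam mu *
          ((Fintype.card F : ℂ) - 1) ^ (pSize lam - pInter lam mu) := by
      have c1 : (S.filter (fun p => mu p.1 p.2 = 1)).card = pInter lam mu := by
        rw [hSdef, Finset.filter_filter]; rfl
      have c2 : S.card = pSize lam := by rw [hSdef]; rfl
      have c3 := Finset.card_filter_add_card_filter_not (s := S) (fun p => mu p.1 p.2 = 1)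
      rw [Finset.prod_ite, Finset.prod_const, Finset.prod_const, c1]
      congr 2
      omega
    have hL : ∑ p ∈ S, (WW P (B p) p.1 p.2).card + pCrs P lam = pDimL P lam := by
      have e1 : pCrs P lam = ∑ p ∈ S, (Finset.univ.filter
          (fun s => (P p.1 s ∧ s < p.2) ∧ s ∈ B p)).card := by
        unfold pCrs
        rw [Finset.card_eq_sum_card_fiberwise (t := S) (f := fun t => (t.2.1, t.2.2.2))]
        · refine Finset.sum_congr rfl fun p hp => ?_
          refine Finset.card_bij (fun t _ => t.2.2.1) ?_ ?_ ?_
          · rintro ⟨i, j, k, l⟩ ht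
            simp only [Finset.mem_filter, Finset.mem_univ, true_and] at ht ⊢
            obtain ⟨⟨h1, h2, h3, h4, h5⟩, rfl⟩ := ht
            exact ⟨⟨h2, h3⟩, (hBm _ _).2 ⟨i, h1, h4⟩⟩
          · rintro ⟨i, j, k, l⟩ ht ⟨i', j', k', l'⟩ ht' h
            simp only [Finset.mem_filter, Finset.mem_univ, true_and] at ht ht' h
            obtain ⟨⟨h1, h2, h3, h4, h5⟩, rfl⟩ := ht
            obtain ⟨⟨h1', h2', h3', h4', h5'⟩, h6⟩ := ht'
            simp only [Prod.mk.injEq] at h6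
            obtain ⟨rfl, rfl⟩ := h6
            subst h
            rw [lcol _ _ _ h4 h4']
          · intro s hs
            simp only [Finset.mem_filter, Finset.mem_univ, true_and] at hs
            obtain ⟨i', h1, h2⟩ := (hBm _ _).1 hs.2
            refine ⟨(i', p.1, s, p.2), ?_, rfl⟩
            simp only [Finset.mem_filter, Finset.mem_univ, true_and]
            exact ⟨⟨h1, hs.1.1, hs.1.2, h2, (hS p).1 hp⟩, trivial⟩
        · intro t ht
          simp only [Finset.coe_filter, Finset.mem_univ, true_and, Set.mem_ofPred_eq] at ht
          exact (hS _).2 ht.2.2.2.2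
      have e2 : pDimL P lam = ∑ p ∈ S, (Finset.univ.filter
          (fun s => P p.1 s ∧ s < p.2)).card := by
        unfold pDimL
        rw [Finset.card_eq_sum_card_fiberwise (t := S) (f := fun t => (t.1, t.2.2))]
        · refine Finset.sum_congr rfl fun p hp => ?_
          refine Finset.card_bij (fun t _ => t.2.1) ?_ ?_ ?_
          · rintro ⟨i, j, k⟩ ht
            simp only [Finset.mem_filter, Finset.mem_univ, true_and] at ht ⊢
            obtain ⟨⟨h1, h2, h3⟩, rfl⟩ := ht
            exact ⟨h1, h2⟩
          · rintro ⟨i, j, k⟩ ht ⟨i', j', k'⟩ ht' h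
            simp only [Finset.mem_filter, Finset.mem_univ, true_and] at ht ht' h
            obtain ⟨-, rfl⟩ := ht
            obtain ⟨-, h6⟩ := ht'
            simp only [Prod.mk.injEq] at h6
            obtain ⟨rfl, rfl⟩ := h6
            subst h
            rfl
          · intro s hs
            simp only [Finset.mem_filter, Finset.mem_univ, true_and] at hs
            refine ⟨(p.1, s, p.2), ?_, rfl⟩
            simp only [Finset.mem_filter, Finset.mem_univ, true_and]
            exact ⟨⟨hs.1, hs.2, (hS p).1 hp⟩, trivial⟩
        · intro t ht
          simp only [Finset.coe_filter, Finset.mem_univ, true_and, Set.mem_ofPred_eq] at ht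
          exact (hS _).2 ht.2.2
      rw [e1, e2, ← Finset.sum_add_distrib]
      refine Finset.sum_congr rfl fun p hp => ?_
      have c3 := Finset.card_filter_add_card_filter_not
        (s := Finset.univ.filter (fun s => P p.1 s ∧ s < p.2)) (fun s => s ∈ B p)
      rw [Finset.filter_filter, Finset.filter_filter] at c3
      have c4 : WW P (B p) p.1 p.2 = Finset.univ.filter
          (fun s => (P p.1 s ∧ s < p.2) ∧ ¬ s ∈ B p) := by
        ext s
        rw [mem_WW]
        simp only [Finset.mem_filter, Finset.mem_univ, true_and]
        tauto
      rw [c4, ← c3, add_comm]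
    have hR : ∑ p ∈ S, (VV P p.1 p.2 \ MM P (B p) p.1 p.2 mu).card + pNst lam mu =
        pDimR P lam := by
      have e1 : pNst lam mu = ∑ p ∈ S, (MM P (B p) p.1 p.2 mu).card := by
        unfold pNst
        rw [Finset.card_eq_sum_card_fiberwise (t := S) (f := fun t => (t.1, t.2.2.2))]
        · refine Finset.sum_congr rfl fun p hp => ?_
          refine Finset.card_bij (fun t _ => t.2.1) ?_ ?_ ?_
          · rintro ⟨i, j, k, l⟩ ht
            simp only [Finset.mem_filter, Finset.mem_univ, true_and] at ht ⊢
            obtain ⟨⟨h1, h2, h3, h4⟩, rfl⟩ := ht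
            have hjk := hmuP _ _ h4
            refine mem_MM.2 ⟨mem_VV.2 ⟨h1, hP.2.2 _ _ _ hjk h2⟩, k,
              mem_WW.2 ⟨h2, hP.2.1 _ _ _ hjk h1, ?_⟩, h4⟩
            intro h5
            obtain ⟨i', h6, h7⟩ := (hBm _ _).1 h5
            exact g2 i' j k (h6.trans h1) h7 h4
          · rintro ⟨i, j, k, l⟩ ht ⟨i', j', k', l'⟩ ht' h
            simp only [Finset.mem_filter, Finset.mem_univ, true_and] at ht ht' h
            obtain ⟨⟨h1, h2, h3, h4⟩, rfl⟩ := ht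
            obtain ⟨⟨h1', h2', h3', h4'⟩, h6⟩ := ht'
            simp only [Prod.mk.injEq] at h6
            obtain ⟨rfl, rfl⟩ := h6
            subst h
            rw [mrow _ _ _ h4 h4']
          · intro r hr
            obtain ⟨h1, s, h2, h3⟩ := mem_MM.1 hr
            refine ⟨(p.1, r, s, p.2), ?_, rfl⟩
            simp only [Finset.mem_filter, Finset.mem_univ, true_and]
            exact ⟨⟨(mem_VV.1 h1).1, (mem_WW.1 h2).1, (hS p).1 hp, h3⟩, trivial⟩
        · intro t ht
          simp only [Finset.coe_filter, Finset.mem_univ, true_and, Set.mem_ofPred_eq] at ht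
          exact (hS _).2 ht.2.2.1
      have e2 : pDimR P lam = ∑ p ∈ S, (VV P p.1 p.2).card := by
        unfold pDimR
        rw [Finset.card_eq_sum_card_fiberwise (t := S) (f := fun t => (t.1, t.2.2))]
        · refine Finset.sum_congr rfl fun p hp => ?_
          refine Finset.card_bij (fun t _ => t.2.1) ?_ ?_ ?_
          · rintro ⟨i, j, k⟩ ht
            simp only [Finset.mem_filter, Finset.mem_univ, true_and] at ht ⊢
            obtain ⟨⟨h1, h2, h3⟩, rfl⟩ := ht
            exact mem_VV.2 ⟨h1, h2⟩
          · rintro ⟨i, j, k⟩ ht ⟨i', j', k'⟩ ht' h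
            simp only [Finset.mem_filter, Finset.mem_univ, true_and] at ht ht' h
            obtain ⟨-, rfl⟩ := ht
            obtain ⟨-, h6⟩ := ht'
            simp only [Prod.mk.injEq] at h6
            obtain ⟨rfl, rfl⟩ := h6
            subst h
            rfl
          · intro s hs
            have hs := mem_VV.1 hs
            refine ⟨(p.1, s, p.2), ?_, rfl⟩
            simp only [Finset.mem_filter, Finset.mem_univ, true_and]
            exact ⟨⟨hs.1, hs.2, (hS p).1 hp⟩, trivial⟩
        · intro t ht
          simp only [Finset.coe_filter, Finset.mem_univ, true_and, Set.mem_ofPred_eq] at ht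
          exact (hS _).2 ht.2.2
      rw [e1, e2, ← Finset.sum_add_distrib]
      refine Finset.sum_congr rfl fun p hp => ?_
      exact Finset.card_sdiff_add_card_eq_card fun r hr => (mem_MM.1 hr).1
    rw [heps, ← hL, ← hR]
    simp only [pow_add]
    field_simp

end
end

section
/- Let q be a prime power, ψ : 𝔽_q → ℂ a nontrivial additive character, and m, n ≥ 0. Let 0 ≤ j, l ≤ min(m,n), and let A be an m×n matrix over 𝔽_q with rank A = j. Then Σ_{Y ∈ M_{m×n}(𝔽_q), rank Y = l} ψ(Σ_{r,s} Y_{rs} A_{rs}) = Σ_{a=0}^{l} (−1)^a · q^{(l−a)·j + a(a−1)/2} · [j choose a]_q · N_q(m−j, n−j, l−a). -/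
open scoped Classical

noncomputable section

/-- `N_q(m,n,r)`: the number of `m × n` matrices over the finite field `F` of rank `r`. -/
def NqF (F : Type) [Field F] [Fintype F] (m n r : ℕ) : ℕ :=
  Nat.card {A : Matrix (Fin m) (Fin n) F // A.rank = r}

open Module Submodule

lemma aux_pascal (q : ℕ) (hq : 2 ≤ q) (G : ℕ → ℕ → ℕ)
    (hG1 : ∀ a k, k ≤ a →
      G a k * ∏ i ∈ Finset.range k, (q ^ (i + 1) - 1) =
        ∏ i ∈ Finset.range k, (q ^ (a - k + i + 1) - 1))
    (hG2 : ∀ a k, a < k → G a k = 0) (j a : ℕ) :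
    (G (j+1) (a+1) : ℂ) = (q:ℂ)^(a+1) * G j (a+1) + G j a := by
  have hz : (G (j+1) (a+1) : ℤ) = (q:ℤ)^(a+1) * G j (a+1) + G j a := by
    set P : ℕ → ℤ := fun k => ∏ i ∈ Finset.range k, ((q:ℤ) ^ (i + 1) - 1) with hP
    have hPs : ∀ k, P (k+1) = P k * ((q:ℤ)^(k+1) - 1) := fun k => Finset.prod_range_succ _ _
    have hP0 : ∀ k, P k ≠ 0 := by
      intro k
      refine Finset.prod_ne_zero_iff.2 fun i _ => ?_
      have : (1:ℤ) < (q:ℤ)^(i+1) := one_lt_pow₀ (by exact_mod_cast hq) (by omega)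
      omega
    have hc : ∀ i : ℕ, (((q ^ (i+1) - 1 : ℕ)) : ℤ) = (q:ℤ)^(i+1) - 1 := by
      intro i
      rw [Nat.cast_sub (Nat.one_le_pow _ _ (by omega))]; simp
    have key : ∀ a k, k ≤ a → (G a k : ℤ) * P k * P (a - k) = P a := by
      intro a k hk
      have h := congrArg (Nat.cast : ℕ → ℤ) (hG1 a k hk)
      push_cast [hc] at h
      have h2 : P a = P (a-k) * ∏ i ∈ Finset.range k, ((q:ℤ) ^ (a - k + i + 1) - 1) := by
        have := Finset.prod_range_add (fun i => ((q:ℤ) ^ (i + 1) - 1)) (a-k) k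
        rw [Nat.sub_add_cancel hk] at this
        exact this
      rw [h2, ← h]; ring
    rcases lt_trichotomy a j with h | h | h
    · obtain ⟨d, rfl⟩ : ∃ d, j = a + 1 + d := ⟨j - a - 1, by omega⟩
      have k1 := key (a+1+d+1) (a+1) (by omega)
      have k2 := key (a+1+d) (a+1) (by omega)
      have k3 := key (a+1+d) a (by omega)
      rw [show a+1+d+1-(a+1) = d+1 by omega, hPs (a+1+d)] at k1
      rw [show a+1+d-(a+1) = d by omega] at k2
      rw [show a+1+d-a = d+1 by omega] at k3
      have : P (a+1) * P (d+1) ≠ 0 := mul_ne_zero (hP0 _) (hP0 _)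
      apply mul_right_cancel₀ this
      have e1 := hPs a
      have e2 := hPs d
      calc _ = (G (a+1+d+1) (a+1) : ℤ) * P (a+1) * P (d+1) := by ring
        _ = _ := k1
        _ = (q:ℤ)^(a+1) * ((q:ℤ)^(d+1) - 1) * P (a+1+d) + ((q:ℤ)^(a+1) - 1) * P (a+1+d) := by ring
        _ = (q:ℤ)^(a+1) * ((q:ℤ)^(d+1) - 1) * (G (a+1+d) (a+1) * P (a+1) * P d)
            + ((q:ℤ)^(a+1) - 1) * (G (a+1+d) a * P a * P (d+1)) := by rw [k2, k3]
        _ = _ := by rw [e1, e2]; ring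
    · subst h
      have k1 := key (a+1) (a+1) le_rfl
      have k2 := key a a le_rfl
      have p0 : P 0 = 1 := by simp [hP]
      simp only [Nat.sub_self, p0, mul_one] at k1 k2
      have g1 := mul_right_cancel₀ (hP0 (a+1)) (k1.trans (one_mul _).symm)
      have g2 := mul_right_cancel₀ (hP0 a) (k2.trans (one_mul _).symm)
      rw [g1, g2, hG2 a (a+1) (by omega)]; simp
    · rw [hG2 (j+1) (a+1) (by omega), hG2 j (a+1) (by omega), hG2 j a h]; simp
  exact_mod_cast hz

lemma aux_G0 (q : ℕ) (G : ℕ → ℕ → ℕ)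
    (hG1 : ∀ a k, k ≤ a →
      G a k * ∏ i ∈ Finset.range k, (q ^ (i + 1) - 1) =
        ∏ i ∈ Finset.range k, (q ^ (a - k + i + 1) - 1)) (j : ℕ) : G j 0 = 1 := by
  simpa using hG1 j 0 (by omega)

/-- abstract right-hand side -/
def aR (q : ℕ) (G : ℕ → ℕ → ℕ) (N : ℕ → ℕ) (j l : ℕ) : ℂ :=
  ∑ a ∈ Finset.range (l + 1),
        (-1 : ℂ) ^ a * (q : ℂ) ^ ((l - a) * j + a * (a - 1) / 2) *
          (G j a : ℂ) * (N (l - a) : ℂ)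

lemma aR_rec (q : ℕ) (hq : 2 ≤ q) (G : ℕ → ℕ → ℕ)
    (hG1 : ∀ a k, k ≤ a →
      G a k * ∏ i ∈ Finset.range k, (q ^ (i + 1) - 1) =
        ∏ i ∈ Finset.range k, (q ^ (a - k + i + 1) - 1))
    (hG2 : ∀ a k, a < k → G a k = 0) (N : ℕ → ℕ) (j l : ℕ) :
    aR q G N (j+1) (l+1) = (q:ℂ)^(l+1) * aR q G N j (l+1) - (q:ℂ)^l * aR q G N j l := by
  unfold aR
  rw [Finset.sum_range_succ', Finset.sum_range_succ' (n := l+1)]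
  rw [mul_add ((q:ℂ)^(l+1)), Finset.mul_sum, Finset.mul_sum, add_sub_right_comm, ← Finset.sum_sub_distrib]
  congr 1
  · apply Finset.sum_congr rfl
    intro a ha
    have ha : a ≤ l := by simpa [Nat.lt_succ_iff] using ha
    obtain ⟨d, rfl⟩ := Nat.exists_eq_add_of_le ha
    have e : (a+1)*(a+1-1)/2 = a*(a-1)/2 + a := by
      rw [← Nat.choose_two_right, ← Nat.choose_two_right, Nat.choose_succ_succ' a 1]
      simp [add_comm]
    rw [aux_pascal q hq G hG1 hG2, e, show a + d + 1 - (a+1) = d by omega,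
      show a + d - a = d by omega]
    generalize a*(a-1)/2 = t
    ring
  · simp [aux_G0 q G hG1]
    ring

lemma aR_zero_l (q : ℕ) (G : ℕ → ℕ → ℕ)
    (hG1 : ∀ a k, k ≤ a →
      G a k * ∏ i ∈ Finset.range k, (q ^ (i + 1) - 1) =
        ∏ i ∈ Finset.range k, (q ^ (a - k + i + 1) - 1)) (N : ℕ → ℕ) (j : ℕ) :
    aR q G N j 0 = N 0 := by
  simp [aR, aux_G0 q G hG1]

lemma aR_zero_j (q : ℕ) (G : ℕ → ℕ → ℕ)
    (hG1 : ∀ a k, k ≤ a →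
      G a k * ∏ i ∈ Finset.range k, (q ^ (i + 1) - 1) =
        ∏ i ∈ Finset.range k, (q ^ (a - k + i + 1) - 1))
    (hG2 : ∀ a k, a < k → G a k = 0) (N : ℕ → ℕ) (l : ℕ) :
    aR q G N 0 l = N l := by
  unfold aR
  rw [Finset.sum_range_succ']
  simp [aux_G0 q G hG1, hG2]

section

variable {F : Type} [Field F] [Fintype F]

/-- the column rank of a family -/
def crk {m n : ℕ} (Y : Fin n → Fin m → F) : ℕ := finrank F (span F (Set.range Y))

/-- subspace sum -/
lemma sub_sum (ψ : F → ℂ)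
    (hψadd : ∀ a b, ψ (a + b) = ψ a * ψ b) (hψ0 : ψ 0 = 1) (hψnt : ∃ a, ψ a ≠ 1)
    {m : ℕ} (W : Submodule F (Fin (m+1) → F)) :
    (∑ y : Fin (m+1) → F, if y ∈ W then ψ (y 0) else 0) =
      if ∀ y ∈ W, y 0 = 0 then (Fintype.card F : ℂ) ^ finrank F W else 0 := by
  split_ifs with h
  · have : ∀ y : Fin (m+1) → F, (if y ∈ W then ψ (y 0) else 0) = if y ∈ W then 1 else 0 := by
      intro y
      split_ifs with hy
      · rw [h y hy, hψ0]
      · rfl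
    simp only [this]
    rw [Finset.sum_boole]
    have h2 := Module.card_eq_pow_finrank (K := F) (V := W)
    rw [← Nat.cast_pow, ← h2, Fintype.card_subtype]
  · push Not at h
    obtain ⟨y0, hy0, h0⟩ := h
    obtain ⟨c, hc⟩ := hψnt
    set z : Fin (m+1) → F := (c / y0 0) • y0 with hz
    have hzW : z ∈ W := W.smul_mem _ hy0
    have hz0 : z 0 = c := by simp [hz, h0]
    have : (∑ y : Fin (m+1) → F, if y ∈ W then ψ (y 0) else 0)
        = ψ c * ∑ y : Fin (m+1) → F, if y ∈ W then ψ (y 0) else 0 := by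
      rw [Finset.mul_sum, ← Equiv.sum_comp (Equiv.addLeft z)]
      apply Finset.sum_congr rfl
      intro y _
      simp only [Equiv.coe_addLeft, W.add_mem_iff_right hzW, Pi.add_apply, hψadd, hz0]
      split_ifs <;> simp
    have h3 : (1 - ψ c) * (∑ y : Fin (m+1) → F, if y ∈ W then ψ (y 0) else 0) = 0 := by
      rw [sub_mul, one_mul, ← this, sub_self]
    rcases mul_eq_zero.1 h3 with h4 | h4
    · exact absurd (sub_eq_zero.1 h4).symm hc
    · exact h4

lemma col_sum (ψ : F → ℂ)
    (hψadd : ∀ a b, ψ (a + b) = ψ a * ψ b) (hψ0 : ψ 0 = 1) (hψnt : ∃ a, ψ a ≠ 1)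
    {m : ℕ} (W : Submodule F (Fin (m+1) → F)) (l : ℕ) :
    (∑ y : Fin (m+1) → F, if finrank F (W ⊔ span F {y} : Submodule F _) = l then ψ (y 0) else 0) =
      if ∀ y ∈ W, y 0 = 0 then
        ((if finrank F W = l then (Fintype.card F : ℂ) ^ finrank F W else 0) -
         (if finrank F W + 1 = l then (Fintype.card F : ℂ) ^ finrank F W else 0)) else 0 := by
  have hall : (∑ y : Fin (m+1) → F, ψ (y 0)) = 0 := by
    have := sub_sum ψ hψadd hψ0 hψnt (m := m) ⊤
    simp only [mem_top, if_true] at this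
    rw [this, if_neg]
    push Not
    exact ⟨fun _ => 1, trivial, by simp⟩
  have h1 : ∀ y : Fin (m+1) → F, (if finrank F (W ⊔ span F {y} : Submodule F _) = l then ψ (y 0) else 0)
     = (if finrank F W = l then (if y ∈ W then ψ (y 0) else 0) else 0) +
       (if finrank F W + 1 = l then ψ (y 0) - (if y ∈ W then ψ (y 0) else 0) else 0) := by
    intro y
    by_cases hy : y ∈ W
    · have : W ⊔ span F {y} = W := by simpa using hy
      rw [this]; simp [hy]
    · rw [finrank_sup_span_singleton hy]; simp [hy]
  simp only [h1]
  rw [Finset.sum_add_distrib]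
  have h2 := sub_sum ψ hψadd hψ0 hψnt W
  by_cases ha : finrank F W = l <;> by_cases hb : finrank F W + 1 = l <;>
    simp only [ha, hb, if_true, if_false, Finset.sum_sub_distrib, hall, h2, Finset.sum_const_zero] <;> 
    split_ifs <;> simp_all

/-- pairing with normal form -/
def pr {m n : ℕ} (j : ℕ) (Y : Fin n → Fin m → F) : F :=
  ∑ s, ∑ r, Y s r * (if (r : ℕ) = s ∧ (r : ℕ) < j then 1 else 0)

lemma pr_succ {m n : ℕ} (j : ℕ) (y : Fin (m+1) → F) (Y : Fin n → Fin (m+1) → F) :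
    pr (j+1) (Fin.cons y Y : Fin (n+1) → Fin (m+1) → F) = y 0 + pr j (fun s r => Y s r.succ) := by
  unfold pr
  rw [Fin.sum_univ_succ]
  congr 1
  · rw [Fin.sum_univ_succ]; simp
  · apply Finset.sum_congr rfl
    intro s _
    rw [Fin.sum_univ_succ]; simp

def aS (ψ : F → ℂ) (m n j l : ℕ) : ℂ :=
  ∑ Y : Fin n → Fin m → F, if crk Y = l then ψ (pr j Y) else 0

lemma crk_cons {m n : ℕ} (y : Fin m → F) (Y : Fin n → Fin m → F) :
    crk (Fin.cons y Y : Fin (n+1) → Fin m → F) =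
      finrank F (span F (Set.range Y) ⊔ span F {y} : Submodule F _) := by
  unfold crk
  rw [Fin.range_cons, span_insert, sup_comm]

def zc (F : Type) [Field F] (m : ℕ) : (Fin m → F) →ₗ[F] (Fin (m+1) → F) where
  toFun y := Fin.cons 0 y
  map_add' x y := by ext i; refine Fin.cases ?_ (fun i => ?_) i <;> simp
  map_smul' c y := by ext i; refine Fin.cases ?_ (fun i => ?_) i <;> simp

lemma zc_inj (m : ℕ) : Function.Injective (zc F m) := by
  intro x y h
  funext i
  have := congrFun h i.succ
  simpa [zc] using this

lemma crk_zc {m n : ℕ} (Y : Fin n → Fin m → F) : crk (fun s => zc F m (Y s)) = crk Y := by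
  unfold crk
  have : Set.range (fun s => zc F m (Y s)) = zc F m '' Set.range Y := by
    rw [← Set.range_comp]; rfl
  rw [this, span_image]
  exact (LinearEquiv.finrank_eq (Submodule.equivMapOfInjective _ (zc_inj m) _)).symm

lemma aS_rec0 (ψ : F → ℂ)
    (hψadd : ∀ a b, ψ (a + b) = ψ a * ψ b) (hψ0 : ψ 0 = 1) (hψnt : ∃ a, ψ a ≠ 1)
    (m n j l : ℕ) :
    aS ψ (m+1) (n+1) (j+1) l = ∑ Y : Fin n → Fin m → F, ψ (pr j Y) *
      ((if crk Y = l then (Fintype.card F : ℂ) ^ crk Y else 0) -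
         (if crk Y + 1 = l then (Fintype.card F : ℂ) ^ crk Y else 0)) := by
  unfold aS
  rw [← Equiv.sum_comp (Fin.consEquiv (fun _ : Fin (n+1) => Fin (m+1) → F)), Fintype.sum_prod_type_right]
  have h1 : ∀ Y : Fin n → Fin (m+1) → F,
     (∑ y : Fin (m+1) → F, if crk ((Fin.consEquiv (fun _ : Fin (n+1) => Fin (m+1) → F)) (y, Y)) = l then
        ψ (pr (j+1) ((Fin.consEquiv (fun _ : Fin (n+1) => Fin (m+1) → F)) (y, Y))) else 0) =
      ψ (pr j (fun s r => Y s r.succ)) * 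
      if ∀ y ∈ span F (Set.range Y), y 0 = 0 then
        ((if crk Y = l then (Fintype.card F : ℂ) ^ crk Y else 0) -
         (if crk Y + 1 = l then (Fintype.card F : ℂ) ^ crk Y else 0)) else 0 := by
    intro Y
    have := col_sum ψ hψadd hψ0 hψnt (span F (Set.range Y)) l
    have e0 : crk Y = finrank F (span F (Set.range Y)) := rfl
    rw [e0, ← this, Finset.mul_sum]
    apply Finset.sum_congr rfl
    intro y _
    have e : (Fin.consEquiv (fun _ : Fin (n+1) => Fin (m+1) → F)) (y, Y) = Fin.cons y Y := rfl
    rw [e, crk_cons, pr_succ, hψadd]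
    split_ifs <;> ring
  simp only [h1]
  symm
  refine Fintype.sum_of_injective (fun (Y : Fin n → Fin m → F) s => zc F m (Y s)) ?_ _ _ ?_ ?_
  · intro X Y h
    funext s
    exact zc_inj m (congrFun h s)
  · intro Y hY
    rw [if_neg, mul_zero]
    intro h
    apply hY
    refine ⟨fun s r => Y s r.succ, ?_⟩
    funext s
    funext i
    refine Fin.cases ?_ (fun i => ?_) i
    · exact (h (Y s) (subset_span ⟨s, rfl⟩)).symm
    · rfl
  · intro Y
    have hz : ∀ y ∈ span F (Set.range fun s => zc F m (Y s)), y 0 = 0 := by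
      intro y hy
      have : span F (Set.range fun s => zc F m (Y s)) ≤ LinearMap.ker (LinearMap.proj (R := F) (φ := fun _ : Fin (m+1) => F) 0) := by
        rw [span_le]
        rintro _ ⟨s, rfl⟩
        rfl
      exact this hy
    rw [if_pos hz, crk_zc]
    rfl

lemma aS_rec (ψ : F → ℂ)
    (hψadd : ∀ a b, ψ (a + b) = ψ a * ψ b) (hψ0 : ψ 0 = 1) (hψnt : ∃ a, ψ a ≠ 1)
    (m n j l : ℕ) :
    aS ψ (m+1) (n+1) (j+1) (l+1) =
     (Fintype.card F : ℂ)^(l+1) * aS ψ m n j (l+1) - (Fintype.card F : ℂ)^l * aS ψ m n j l := by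
  rw [aS_rec0 ψ hψadd hψ0 hψnt]
  unfold aS
  rw [Finset.mul_sum, Finset.mul_sum, ← Finset.sum_sub_distrib]
  apply Finset.sum_congr rfl
  intro Y _
  by_cases h1 : crk Y = l
  · simp [h1]; ring
  · by_cases h2 : crk Y = l + 1
    · simp [h2]; ring
    · simp [h1, h2]

lemma aS_rec_zero (ψ : F → ℂ)
    (hψadd : ∀ a b, ψ (a + b) = ψ a * ψ b) (hψ0 : ψ 0 = 1) (hψnt : ∃ a, ψ a ≠ 1)
    (m n j : ℕ) :
    aS ψ (m+1) (n+1) (j+1) 0 = aS ψ m n j 0 := by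
  rw [aS_rec0 ψ hψadd hψ0 hψnt]
  unfold aS
  apply Finset.sum_congr rfl
  intro Y _
  by_cases h1 : crk Y = 0 <;> simp [h1]

lemma crk_eq_rank {m n : ℕ} (A : Matrix (Fin m) (Fin n) F) :
    crk (Matrix.transpose A : Fin n → Fin m → F) = A.rank := by
  rw [Matrix.rank_eq_finrank_span_cols]; rfl

lemma aS_zero (ψ : F → ℂ) (hψ0 : ψ 0 = 1) (m n l : ℕ) : aS ψ m n 0 l = NqF F m n l := by
  unfold aS NqF
  have : ∀ Y : Fin n → Fin m → F, pr 0 Y = 0 := by intro Y; simp [pr]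
  simp only [this, hψ0]
  rw [Finset.sum_boole, Nat.card_eq_fintype_card, Fintype.card_subtype]
  congr 1
  apply Finset.card_bij (fun (Y : Fin n → Fin m → F) _ => (Matrix.transpose Y : Matrix (Fin m) (Fin n) F))
  · intro Y hY
    simp only [Finset.mem_filter, Finset.mem_univ, true_and] at hY ⊢
    rw [← crk_eq_rank]; exact hY
  · intro X _ Y _ h
    exact Matrix.transpose_injective h
  · intro A hA
    simp only [Finset.mem_filter, Finset.mem_univ, true_and] at hA
    refine ⟨Matrix.transpose A, Finset.mem_filter.2 ⟨Finset.mem_univ _, ?_⟩, rfl⟩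
    rw [crk_eq_rank]; exact hA

lemma aS_eq (ψ : F → ℂ)
    (hψadd : ∀ a b, ψ (a + b) = ψ a * ψ b) (hψ0 : ψ 0 = 1) (hψnt : ∃ a, ψ a ≠ 1)
    (G : ℕ → ℕ → ℕ)
    (hG1 : ∀ a k, k ≤ a →
      G a k * ∏ i ∈ Finset.range k, (Fintype.card F ^ (i + 1) - 1) =
        ∏ i ∈ Finset.range k, (Fintype.card F ^ (a - k + i + 1) - 1))
    (hG2 : ∀ a k, a < k → G a k = 0) (j : ℕ) : ∀ (m n l : ℕ), j ≤ m → j ≤ n →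
    aS ψ m n j l = aR (Fintype.card F) G (NqF F (m-j) (n-j)) j l := by
  have hq : 2 ≤ Fintype.card F := Fintype.one_lt_card
  induction j with
  | zero => intro m n l _ _; rw [aS_zero ψ hψ0, aR_zero_j _ G hG1 hG2]; rfl
  | succ j ih =>
    intro m n l hm hn
    obtain ⟨m, rfl⟩ : ∃ k, m = k + 1 := ⟨m - 1, by omega⟩
    obtain ⟨n, rfl⟩ : ∃ k, n = k + 1 := ⟨n - 1, by omega⟩
    rw [Nat.add_sub_add_right, Nat.add_sub_add_right]
    cases l with
    | zero =>
      rw [aS_rec_zero ψ hψadd hψ0 hψnt, ih _ _ _ (by omega) (by omega), aR_zero_l _ G hG1,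
        aR_zero_l _ G hG1]
    | succ l =>
      rw [aS_rec ψ hψadd hψ0 hψnt, ih _ _ _ (by omega) (by omega),
        ih _ _ _ (by omega) (by omega), aR_rec _ hq G hG1 hG2]

/-- normal form matrix -/
def nf (F : Type) [Field F] (m n j : ℕ) : Matrix (Fin m) (Fin n) F :=
  fun r s => if (r : ℕ) = s ∧ (r : ℕ) < j then 1 else 0

lemma nf_rank (j : ℕ) : ∀ m n, j ≤ m → j ≤ n → (nf F m n j).rank = j := by
  induction j with
  | zero =>
    intro m n _ _
    have : nf F m n 0 = 0 := by ext; simp [nf]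
    rw [this, Matrix.rank_zero]
  | succ j ih =>
    intro m n hm hn
    obtain ⟨m, rfl⟩ : ∃ k, m = k + 1 := ⟨m - 1, by omega⟩
    obtain ⟨n, rfl⟩ : ∃ k, n = k + 1 := ⟨n - 1, by omega⟩
    rw [← crk_eq_rank]
    have e : (Matrix.transpose (nf F (m+1) (n+1) (j+1)) : Fin (n+1) → Fin (m+1) → F) =
      Fin.cons (Pi.single 0 1) (fun s => zc F m ((nf F m n j).transpose s)) := by
      funext s
      refine Fin.cases ?_ (fun s => ?_) s
      · funext r
        refine Fin.cases ?_ (fun r => ?_) r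
        · simp [nf, Matrix.transpose]
        · simp [nf, Matrix.transpose]
      · funext r
        refine Fin.cases ?_ (fun r => ?_) r
        · simp [nf, Matrix.transpose, zc]
        · simp [nf, Matrix.transpose, zc]
    rw [e, crk_cons, finrank_sup_span_singleton]
    · have := crk_zc (fun s => (nf F m n j).transpose s)
      unfold crk at this
      rw [this]
      have h2 := crk_eq_rank (nf F m n j)
      rw [ih m n (by omega) (by omega)] at h2
      unfold crk at h2
      exact congrArg (· + 1) h2
    · intro hy
      have : span F (Set.range fun s => zc F m ((nf F m n j).transpose s)) ≤ LinearMap.ker (LinearMap.proj (R := F) (φ := fun _ : Fin (m+1) => F) 0) := by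
        rw [span_le]
        rintro _ ⟨s, rfl⟩
        rfl
      have h := this hy
      simp at h

lemma lin_equiv {V W : Type} [AddCommGroup V] [Module F V] [AddCommGroup W] [Module F W]
    [FiniteDimensional F V] [FiniteDimensional F W] (f g : V →ₗ[F] W)
    (h : finrank F (LinearMap.range f) = finrank F (LinearMap.range g)) :
    ∃ (P : V ≃ₗ[F] V) (Q : W ≃ₗ[F] W), ∀ x, g (P x) = Q (f x) := by
  obtain ⟨C, hC⟩ := (LinearMap.ker f).exists_isCompl
  obtain ⟨D, hD⟩ := (LinearMap.ker g).exists_isCompl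
  obtain ⟨A, hA⟩ := (LinearMap.range f).exists_isCompl
  obtain ⟨B, hB⟩ := (LinearMap.range g).exists_isCompl
  have hf := f.finrank_range_add_finrank_ker
  have hg := g.finrank_range_add_finrank_ker
  have hA' := Submodule.finrank_add_eq_of_isCompl hA
  have hB' := Submodule.finrank_add_eq_of_isCompl hB
  let ρ : LinearMap.range f ≃ₗ[F] LinearMap.range g := LinearEquiv.ofFinrankEq _ _ h
  let κ : LinearMap.ker f ≃ₗ[F] LinearMap.ker g := LinearEquiv.ofFinrankEq _ _ (by omega)
  let α : A ≃ₗ[F] B := LinearEquiv.ofFinrankEq _ _ (by omega)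
  let cf := f.kerComplementEquivRange hC.symm
  let cg := g.kerComplementEquivRange hD.symm
  let γ : C ≃ₗ[F] D := cf.trans (ρ.trans cg.symm)
  let eC := Submodule.prodEquivOfIsCompl _ _ hC
  let eD := Submodule.prodEquivOfIsCompl _ _ hD
  let eA := Submodule.prodEquivOfIsCompl _ _ hA
  let eB := Submodule.prodEquivOfIsCompl _ _ hB
  refine ⟨eC.symm.trans ((κ.prodCongr γ).trans eD), eA.symm.trans ((ρ.prodCongr α).trans eB), ?_⟩
  intro x
  obtain ⟨⟨k, c⟩, rfl⟩ := eC.surjective x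
  have h1 : f (eC (k, c)) = (cf c : W) := by
    simp [eC, cf]
  have h2 : eA.symm (cf c : W) = (cf c, 0) := by
    rw [LinearEquiv.symm_apply_eq]; simp [eA]
  have h3 : ∀ d : D, g d = (cg d : W) := by intro d; simp [cg]
  rw [h1]
  simp only [LinearEquiv.trans_apply, LinearEquiv.symm_apply_apply, h2]
  simp [eD, eB, h3, γ]

lemma mat_equiv {m n : ℕ} (A B : Matrix (Fin m) (Fin n) F) (h : A.rank = B.rank) :
    ∃ (P : Matrix (Fin n) (Fin n) F) (Q : Matrix (Fin m) (Fin m) F), IsUnit P ∧ IsUnit Q ∧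
      A = Q * B * P := by
  obtain ⟨P, Q, hPQ⟩ := lin_equiv B.mulVecLin A.mulVecLin h.symm
  refine ⟨LinearMap.toMatrix' P.symm.toLinearMap, LinearMap.toMatrix' Q.toLinearMap, ?_, ?_, ?_⟩
  · refine IsUnit.of_mul_eq_one (LinearMap.toMatrix' P.toLinearMap) ?_
    rw [← LinearMap.toMatrix'_comp]; simp
  · refine IsUnit.of_mul_eq_one (LinearMap.toMatrix' Q.symm.toLinearMap) ?_
    rw [← LinearMap.toMatrix'_comp]; simp
  · apply Matrix.mulVec_injective
    funext x
    rw [← Matrix.mulVec_mulVec, ← Matrix.mulVec_mulVec, LinearMap.toMatrix'_mulVec,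
      LinearMap.toMatrix'_mulVec]
    have := hPQ (P.symm x)
    simpa using this

lemma pair_trace {m n : ℕ} (Y A : Matrix (Fin m) (Fin n) F) :
    ∑ r, ∑ s, Y r s * A r s = (Y.transpose * A).trace := by
  rw [Finset.sum_comm]
  simp [Matrix.trace, Matrix.mul_apply]

lemma sum_reduce (ψ : F → ℂ) {m n : ℕ} (A B : Matrix (Fin m) (Fin n) F) (h : A.rank = B.rank) (l : ℕ) :
    (∑ Y : Matrix (Fin m) (Fin n) F, if Y.rank = l then ψ (∑ r, ∑ s, Y r s * A r s) else 0) =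
    ∑ Y : Matrix (Fin m) (Fin n) F, if Y.rank = l then ψ (∑ r, ∑ s, Y r s * B r s) else 0 := by
  obtain ⟨P, Q, hP, hQ, rfl⟩ := mat_equiv A B h
  have hP' : IsUnit P.transpose.det := by
    rw [Matrix.det_transpose]; exact (Matrix.isUnit_iff_isUnit_det P).1 hP
  have hQ' : IsUnit Q.transpose.det := by
    rw [Matrix.det_transpose]; exact (Matrix.isUnit_iff_isUnit_det Q).1 hQ
  let e : Matrix (Fin m) (Fin n) F → Matrix (Fin m) (Fin n) F := fun Y => Q.transpose * Y * P.transpose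
  have he : Function.Injective e := by
    intro X Y hXY
    simp only [e] at hXY
    have h1 := congrArg (fun Z => Q.transpose⁻¹ * (Z * P.transpose⁻¹)) hXY
    simp only [Matrix.mul_nonsing_inv_cancel_right _ _ hP',
      Matrix.nonsing_inv_mul_cancel_left _ _ hQ'] at h1
    exact h1
  refine Fintype.sum_bijective e (Finite.injective_iff_bijective.1 he) _ _ ?_
  intro Y
  have h1 : (e Y).rank = Y.rank := by
    simp only [e]
    rw [Matrix.rank_mul_eq_left_of_isUnit_det _ _ hP', Matrix.rank_mul_eq_right_of_isUnit_det _ _ hQ']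
  rw [h1, pair_trace, pair_trace]
  have h2 : (Y.transpose * (Q * B * P)).trace = ((e Y).transpose * B).trace := by
    simp only [e, Matrix.transpose_mul, Matrix.transpose_transpose]
    rw [← Matrix.mul_assoc, Matrix.trace_mul_comm]
    simp only [Matrix.mul_assoc]
  rw [h2]

end

theorem stmt_13 (F : Type) [Field F] [Fintype F] (ψ : F → ℂ)
    (hψadd : ∀ a b, ψ (a + b) = ψ a * ψ b) (hψ0 : ψ 0 = 1) (hψnt : ∃ a, ψ a ≠ 1)
    (q : ℕ) (hq : q = Fintype.card F)
    (G : ℕ → ℕ → ℕ)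
    (hG1 : ∀ a k, k ≤ a →
      G a k * ∏ i ∈ Finset.range k, (q ^ (i + 1) - 1) =
        ∏ i ∈ Finset.range k, (q ^ (a - k + i + 1) - 1))
    (hG2 : ∀ a k, a < k → G a k = 0)
    (m n j l : ℕ) (hj : j ≤ min m n) (hl : l ≤ min m n)
    (A : Matrix (Fin m) (Fin n) F) (hA : A.rank = j) :
    ∑ Y ∈ Finset.univ.filter (fun Y : Matrix (Fin m) (Fin n) F => Y.rank = l),
        ψ (∑ r, ∑ s, Y r s * A r s) =
      ∑ a ∈ Finset.range (l + 1),
        (-1 : ℂ) ^ a * (q : ℂ) ^ ((l - a) * j + a * (a - 1) / 2) *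
          (G j a : ℂ) * (NqF F (m - j) (n - j) (l - a) : ℂ) := by
  subst hq
  have hjm : j ≤ m := le_trans hj (min_le_left _ _)
  have hjn : j ≤ n := le_trans hj (min_le_right _ _)
  have key := aS_eq ψ hψadd hψ0 hψnt G hG1 hG2 j m n l hjm hjn
  unfold aR at key
  rw [← key, Finset.sum_filter, sum_reduce ψ A (nf F m n j) (by rw [hA, nf_rank j m n hjm hjn])]
  unfold aS
  refine Fintype.sum_bijective (fun Y : Matrix (Fin m) (Fin n) F => (Y.transpose : Fin n → Fin m → F))
    ?_ _ _ ?_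
  · exact ⟨Matrix.transpose_injective, fun Y => ⟨Matrix.transpose Y, rfl⟩⟩
  · intro Y
    rw [crk_eq_rank, Finset.sum_comm]
    rfl

end
end
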